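/- arXiv:1207.4305 — 9 statements merged into one kernel-verified Lean document; each statement's English description precedes it below -/
import Mathlib

section
/- Let M be a mechanism assigning to each element d of a set D (equipped with a symmetric adjacency relation Adj) a probability measure M(d) on a measurable space (R, 𝓜), and let ε, δ ≥ 0. If M is (ε,δ)-differentially private, i.e. M(d)(S) ≤ e^ε · M(d')(S) + δ for all adjacent d, d' and all S ∈ 𝓜, then for every adjacent pair d, d' there exists a (nonnegative) measure μ on (R, 𝓜) which is δ-bounded (μ(S) ≤ δ for all S ∈ 𝓜) and satisfies M(d)(S) ≤ e^ε · M(d')(S) + μ(S) for all S ∈ 𝓜. -/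
open MeasureTheory ENNReal

/-- If a mechanism `M : D → Measure R` is `(ε,δ)`-differentially private,
then for every adjacent pair `d, d'` there is a `δ`-bounded nonnegative measure `μ`
with `M d S ≤ e^ε * M d' S + μ S` for all measurable `S`. -/
theorem dp_implies_delta_bounded_measure
    {D : Type*} {R : Type*} [MeasurableSpace R]
    (Adj : D → D → Prop) (hAdjSymm : Symmetric Adj)
    (M : D → Measure R) (hprob : ∀ d, IsProbabilityMeasure (M d))
    (ε δ : ℝ) (hε : 0 ≤ ε) (hδ : 0 ≤ δ)
    (hDP : ∀ d d', Adj d d' → ∀ S : Set R, MeasurableSet S →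
      M d S ≤ ENNReal.ofReal (Real.exp ε) * M d' S + ENNReal.ofReal δ) :
    ∀ d d', Adj d d' → ∃ μ : Measure R,
      (∀ S : Set R, MeasurableSet S → μ S ≤ ENNReal.ofReal δ) ∧
      (∀ S : Set R, MeasurableSet S →
        M d S ≤ ENNReal.ofReal (Real.exp ε) * M d' S + μ S) := by
  intro d d' hdd
  have := hprob d
  have := hprob d'
  obtain ⟨Q, hQf, hQ⟩ : ∃ Q : Measure R, IsFiniteMeasure Q ∧
      ∀ S, Q S = ENNReal.ofReal (Real.exp ε) * M d' S :=
    ⟨(Real.exp ε).toNNReal • M d', inferInstance, fun S => rfl⟩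
  have hDP' := hDP d d' hdd
  simp only [← hQ] at hDP' ⊢
  obtain ⟨s, hs, h1, h2⟩ := hahn_decomposition (M d) Q
  have hle : Q.restrict s ≤ (M d).restrict s := by
    rw [Measure.le_iff]
    intro t ht
    rw [Measure.restrict_apply ht, Measure.restrict_apply ht]
    exact h1 _ (ht.inter hs) Set.inter_subset_right
  have key : ∀ S, MeasurableSet S → ((M d).restrict s - Q.restrict s) S
      = M d (S ∩ s) - Q (S ∩ s) := by
    intro S hS
    rw [Measure.sub_apply hS hle, Measure.restrict_apply hS, Measure.restrict_apply hS]
  refine ⟨(M d).restrict s - Q.restrict s, fun S hS => ?_, fun S hS => ?_⟩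
  · rw [key S hS]
    exact tsub_le_iff_left.2 (hDP' _ (hS.inter hs))
  · rw [key S hS, ← measure_inter_add_diff S hs, ← measure_inter_add_diff (μ := Q) S hs]
    calc M d (S ∩ s) + M d (S \ s)
        ≤ (Q (S ∩ s) + (M d (S ∩ s) - Q (S ∩ s))) + Q (S \ s) :=
          add_le_add le_add_tsub (h2 _ (hS.diff hs) (fun x hx => hx.2))
      _ = _ := by ring
end

section
/- Let P, Q be probability measures on a measurable space (R₁, 𝓜₁), ε ≥ 0, and let μ be a finite nonnegative measure on (R₁, 𝓜₁) such that P(S) ≤ e^ε · Q(S) + μ(S) for all S ∈ 𝓜₁. Let k be a Markov kernel from (R₁, 𝓜₁) to a measurable space (R₂, 𝓜₂). Then for all S ∈ 𝓜₂, ∫ k(r,S) dP(r) ≤ e^ε · ∫ k(r,S) dQ(r) + ∫ k(r,S) dμ(r); moreover the measure ν defined by ν(S) = ∫ k(r,S) dμ(r) has total mass ν(R₂) = μ(R₁). -/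
open MeasureTheory ProbabilityTheory ENNReal

/-- if `P S ≤ e^ε * Q S + μ S` for all measurable `S`, and `κ` is a Markov
kernel, then `∫ κ(r,S) dP ≤ e^ε * ∫ κ(r,S) dQ + ∫ κ(r,S) dμ` for all measurable `S`,
and the measure `ν S = ∫ κ(r,S) dμ` has total mass `ν R₂ = μ R₁`. -/
theorem kernel_integral_dp_bound
    {R₁ R₂ : Type*} [MeasurableSpace R₁] [MeasurableSpace R₂]
    (P Q : Measure R₁) [IsProbabilityMeasure P] [IsProbabilityMeasure Q]
    (μ : Measure R₁) [IsFiniteMeasure μ]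
    (ε : ℝ) (hε : 0 ≤ ε)
    (hbound : ∀ S : Set R₁, MeasurableSet S →
      P S ≤ ENNReal.ofReal (Real.exp ε) * Q S + μ S)
    (κ : Kernel R₁ R₂) [IsMarkovKernel κ] :
    (∀ S : Set R₂, MeasurableSet S →
      ∫⁻ r, κ r S ∂P ≤ ENNReal.ofReal (Real.exp ε) * ∫⁻ r, κ r S ∂Q
        + ∫⁻ r, κ r S ∂μ) ∧
    (∫⁻ r, κ r Set.univ ∂μ = μ Set.univ) := by
  have hle : P ≤ ENNReal.ofReal (Real.exp ε) • Q + μ := by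
    refine Measure.le_iff.2 fun S hS => ?_
    simpa using hbound S hS
  refine ⟨fun S _ => ?_, by simp⟩
  calc ∫⁻ r, κ r S ∂P ≤ ∫⁻ r, κ r S ∂(ENNReal.ofReal (Real.exp ε) • Q + μ) :=
        lintegral_mono' hle le_rfl
    _ = _ := by rw [lintegral_add_measure, lintegral_smul_measure, smul_eq_mul]
end

section
/- Laplace mechanism: let D be a set with a symmetric adjacency relation Adj, let q : D → ℝ^k be a query, and define its ℓ₁-sensitivity Δ₁q = sup{‖q(d) − q(d')‖₁ : Adj(d,d')}. Let ε > 0 and b ≥ Δ₁q/ε, and for each d ∈ D let M(d) be the probability measure on ℝ^k with density u ↦ (1/(2b))^k exp(−‖u − q(d)‖₁/b) with respect to Lebesgue measure (i.e. the law of q(d) + w where w has i.i.d. Laplace(b) coordinates). Then M is ε-differentially private: for all adjacent d, d' and all Borel sets S ⊆ ℝ^k, M(d)(S) ≤ e^ε · M(d')(S). -/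
open MeasureTheory ENNReal

/-- Laplace mechanism: if `‖q d − q d'‖₁ ≤ Δ` for all adjacent `d, d'`
(`Δ` bounds the ℓ₁-sensitivity of `q`), `ε > 0` and `b ≥ Δ/ε`, then the mechanism that
outputs `q d` perturbed by i.i.d. `Lap(b)` noise, i.e. the measure with density
`u ↦ (1/(2b))^k exp(−‖u − q d‖₁/b)` w.r.t. Lebesgue measure, is `ε`-differentially
private. -/
theorem laplace_mechanism_dp
    {D : Type*} {k : ℕ}
    (Adj : D → D → Prop) (hAdjSymm : Symmetric Adj)
    (q : D → (Fin k → ℝ))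
    (Δ ε b : ℝ) (hε : 0 < ε)
    (hsens : ∀ d d', Adj d d' → ∑ i, |q d i - q d' i| ≤ Δ)
    (hb : b ≥ Δ / ε)
    (M : D → Measure (Fin k → ℝ))
    (hM : ∀ d, M d = volume.withDensity (fun u =>
      ENNReal.ofReal ((1 / (2 * b)) ^ k * Real.exp (-(∑ i, |u i - q d i|) / b)))) :
    ∀ d d', Adj d d' → ∀ S : Set (Fin k → ℝ), MeasurableSet S →
      M d S ≤ ENNReal.ofReal (Real.exp ε) * M d' S := by
  intro d d' hadj S hS
  have hs := hsens d d' hadj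
  have hΔ : 0 ≤ Δ := le_trans (Finset.sum_nonneg fun i _ => abs_nonneg _) hs
  have hb0 : 0 ≤ b := le_trans (div_nonneg hΔ hε.le) hb
  have hΔb : Δ ≤ b * ε := (div_le_iff₀ hε).1 hb
  rw [hM d, hM d', withDensity_apply _ hS, withDensity_apply _ hS,
    ← lintegral_const_mul' _ _ ENNReal.ofReal_ne_top]
  refine lintegral_mono fun u => ?_
  rw [← ENNReal.ofReal_mul (Real.exp_pos ε).le]
  apply ENNReal.ofReal_le_ofReal
  have htri : ∑ i, |u i - q d' i| ≤ ∑ i, |u i - q d i| + ∑ i, |q d i - q d' i| := by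
    rw [← Finset.sum_add_distrib]
    exact Finset.sum_le_sum fun i _ => abs_sub_le _ _ _
  have hexp : -(∑ i, |u i - q d i|) / b ≤ ε + -(∑ i, |u i - q d' i|) / b := by
    rcases hb0.eq_or_lt with h | h
    · simp [← h, hε.le]
    · rw [div_le_iff₀ h, add_mul, div_mul_cancel₀ _ h.ne']
      linarith
  have hc : 0 ≤ (1 / (2 * b)) ^ k := by positivity
  calc (1 / (2 * b)) ^ k * Real.exp (-(∑ i, |u i - q d i|) / b)
      ≤ (1 / (2 * b)) ^ k * Real.exp (ε + -(∑ i, |u i - q d' i|) / b) :=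
        mul_le_mul_of_nonneg_left (Real.exp_le_exp.2 hexp) hc
    _ = Real.exp ε * ((1 / (2 * b)) ^ k * Real.exp (-(∑ i, |u i - q d' i|) / b)) := by
        rw [Real.exp_add]; ring
end

section
/- Gaussian mechanism: let D be a set with a symmetric adjacency relation Adj, let q : D → ℝ^k be a query, and define its ℓ₂-sensitivity Δ₂q = sup{‖q(d) − q(d')‖₂ : Adj(d,d')}. Let ε > 0, δ ∈ (0, 1/2), let K ≥ 0 satisfy 𝒬(K) = δ where 𝒬(x) = (1/√(2π)) ∫ₓ^∞ e^{−u²/2} du, and let σ ≥ (Δ₂q/(2ε)) · (K + √(K² + 2ε)). For each d ∈ D let M(d) be the law of q(d) + w, where w is a centered Gaussian vector on ℝ^k with covariance σ² I_k (i.e. i.i.d. N(0,σ²) coordinates). Then M is (ε,δ)-differentially private: for all adjacent d, d' and all Borel sets S ⊆ ℝ^k, M(d)(S) ≤ e^ε · M(d')(S) + δ. -/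
open MeasureTheory ProbabilityTheory ENNReal

lemma gm_pi_withDensity {k : ℕ} (μ ν : Fin k → Measure ℝ) [∀ i, IsProbabilityMeasure (μ i)]
    [∀ i, IsProbabilityMeasure (ν i)] (f : Fin k → ℝ → ℝ≥0∞) (hf : ∀ i, Measurable (f i))
    (h : ∀ i, μ i = (ν i).withDensity (f i)) :
    Measure.pi μ = (Measure.pi ν).withDensity (fun w => ∏ i, f i (w i)) := by
  refine Measure.pi_eq fun s hs => ?_
  have hS : MeasurableSet (Set.univ.pi s) := MeasurableSet.univ_pi hs
  rw [withDensity_apply _ hS, ← lintegral_indicator hS]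
  have e : ∀ w : Fin k → ℝ, (Set.univ.pi s).indicator (fun w => ∏ i, f i (w i)) w
      = ∏ i, (s i).indicator (f i) (w i) := by
    intro w
    by_cases hw : w ∈ Set.univ.pi s
    · rw [Set.indicator_of_mem hw]
      exact Finset.prod_congr rfl fun i _ => by
        rw [Set.indicator_of_mem (hw i (Set.mem_univ i))]
    · rw [Set.indicator_of_notMem hw]
      simp only [Set.mem_pi, Set.mem_univ, true_implies, not_forall] at hw
      obtain ⟨i, hi⟩ := hw
      exact (Finset.prod_eq_zero (Finset.mem_univ i) (Set.indicator_of_notMem hi _)).symm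
  simp_rw [e]
  have hm : ∀ i, Measurable ((s i).indicator (f i)) := fun i => (hf i).indicator (hs i)
  rw [lintegral_prod_eq_prod_lintegral_of_indepFun Finset.univ
    (fun i (w : Fin k → ℝ) => (s i).indicator (f i) (w i))
    (iIndepFun_pi fun i => (hm i).aemeasurable) (fun i => (hm i).comp (measurable_pi_apply i))]
  refine Finset.prod_congr rfl fun i _ => ?_
  rw [h i, withDensity_apply _ (hs i), ← lintegral_indicator (hs i)]
  exact (measurePreserving_eval ν i).lintegral_comp (hm i)

lemma gm_density (a b : ℝ) (V : NNReal) (hV : V ≠ 0) :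
    gaussianReal a V = (gaussianReal b V).withDensity
      (fun x => ENNReal.ofReal (Real.exp (((x - b) ^ 2 - (x - a) ^ 2) / (2 * V)))) := by
  rw [gaussianReal_of_var_ne_zero _ hV, gaussianReal_of_var_ne_zero _ hV,
    ← withDensity_mul _ (measurable_gaussianPDF _ _) (by fun_prop)]
  congr 1
  ext x
  rw [Pi.mul_apply, gaussianPDF, gaussianPDF, ← ENNReal.ofReal_mul (gaussianPDFReal_nonneg _ _ _)]
  congr 1
  rw [gaussianPDFReal, gaussianPDFReal, mul_assoc (Real.sqrt _)⁻¹, ← Real.exp_add]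
  congr 2
  ring

lemma gm_sum_law {k : ℕ} (v : Fin k → ℝ) (V : NNReal) :
    (Measure.pi fun _ : Fin k => gaussianReal 0 V).map (fun w => ∑ i, v i * w i)
      = gaussianReal 0 ((∑ i, v i ^ 2) * V).toNNReal := by
  have hI : iIndepFun (fun i (w : Fin k → ℝ) => v i * w i)
      (Measure.pi fun _ : Fin k => gaussianReal 0 V) :=
    iIndepFun_pi (X := fun i x => v i * x) fun i => by fun_prop
  have hlaw : ∀ i, (Measure.pi fun _ : Fin k => gaussianReal 0 V).map
      (fun w => v i * w i) = (gaussianReal 0 V).map (v i * ·) := by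
    intro i
    have h1 := (measurePreserving_eval (fun _ : Fin k => gaussianReal 0 V) i).map_eq
    have h2 := Measure.map_map (μ := Measure.pi fun _ : Fin k => gaussianReal 0 V)
      (g := fun x : ℝ => v i * x) (f := Function.eval i) (by fun_prop) (by fun_prop)
    rw [h1] at h2
    exact h2.symm
  have hg : ∀ i, HasGaussianLaw (fun w : Fin k → ℝ => v i * w i)
      (Measure.pi fun _ : Fin k => gaussianReal 0 V) := fun i => ⟨by
    rw [hlaw i, gaussianReal_map_const_mul]; infer_instance⟩
  have hs := iIndepFun.hasGaussianLaw_fun_sum hg hI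
  rw [hs.map_eq_gaussianReal]
  have hmean : ∀ i, ∫ w, v i * w i ∂(Measure.pi fun _ : Fin k => gaussianReal 0 V) = 0 := by
    intro i
    have h1 := integral_map (μ := Measure.pi fun _ : Fin k => gaussianReal 0 V)
      (φ := fun w => v i * w i) (f := fun x : ℝ => x) (Measurable.aemeasurable (by fun_prop)) (by fun_prop)
    rw [← h1, hlaw i, gaussianReal_map_const_mul]
    simp
  congr 1
  · rw [integral_finsetSum _ fun i _ => (hg i).integrable]
    exact Finset.sum_eq_zero fun i _ => hmean i
  · congr 1
    have : (fun w : Fin k → ℝ => ∑ i, v i * w i) = ∑ i, fun w : Fin k → ℝ => v i * w i := by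
      ext w; simp
    rw [this, variance_sum_pi (X := fun i x => v i * x) (μ := fun _ => gaussianReal 0 V)]
    · rw [Finset.sum_mul]
      refine Finset.sum_congr rfl fun i _ => ?_
      rw [variance_const_mul, variance_fun_id_gaussianReal]
    · exact fun i => IsGaussian.memLp_two_id.const_mul _

lemma gm_tail (s c K δ : ℝ) (hs : 0 < s) (hc : K * s ≤ c)
    (hQK : (1 / Real.sqrt (2 * Real.pi)) * ∫ u in Set.Ioi K, Real.exp (-u ^ 2 / 2) = δ) :
    gaussianReal 0 (s ^ 2).toNNReal (Set.Ioi c) ≤ ENNReal.ofReal δ := by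
  have h1 : gaussianReal 0 (s ^ 2).toNNReal = (gaussianReal 0 1).map (s * ·) := by
    rw [gaussianReal_map_const_mul, mul_zero, mul_one]
    congr 1
    ext
    simp [sq_nonneg]
  rw [h1, Measure.map_apply (by fun_prop) measurableSet_Ioi]
  have h2 : (s * ·) ⁻¹' Set.Ioi c ⊆ Set.Ioi K := by
    intro x hx
    simp only [Set.mem_preimage, Set.mem_Ioi] at hx ⊢
    nlinarith
  refine (measure_mono h2).trans ?_
  rw [gaussianReal_apply_eq_integral _ one_ne_zero, ← hQK, ← integral_const_mul]
  apply le_of_eq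
  congr 2
  ext x
  simp [gaussianPDFReal]

/-- Gaussian mechanism: if `‖q d − q d'‖₂ ≤ Δ` for all adjacent `d, d'`,
`ε > 0`, `δ ∈ (0,1/2)`, `K ≥ 0` satisfies `𝒬(K) = δ` for the standard Gaussian tail
function `𝒬`, and `σ ≥ (Δ/(2ε))(K + √(K² + 2ε))`, then the mechanism outputting
`q d + w` with `w ∼ N(0, σ² I_k)` is `(ε,δ)`-differentially private. -/
theorem gaussian_mechanism_dp
    {D : Type*} {k : ℕ}
    (Adj : D → D → Prop) (hAdjSymm : Symmetric Adj)
    (q : D → (Fin k → ℝ))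
    (Δ ε δ K σ : ℝ) (hε : 0 < ε) (hδ : 0 < δ) (hδ' : δ < 1 / 2) (hK : 0 ≤ K)
    (hsens : ∀ d d', Adj d d' → Real.sqrt (∑ i, (q d i - q d' i) ^ 2) ≤ Δ)
    (hQK : (1 / Real.sqrt (2 * Real.pi)) * ∫ u in Set.Ioi K, Real.exp (-u ^ 2 / 2) = δ)
    (hσ : σ ≥ Δ / (2 * ε) * (K + Real.sqrt (K ^ 2 + 2 * ε)))
    (M : D → Measure (Fin k → ℝ))
    (hM : ∀ d, M d = (Measure.pi fun _ : Fin k =>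
      gaussianReal 0 ((σ ^ 2).toNNReal)).map (fun w => q d + w)) :
    ∀ d d', Adj d d' → ∀ S : Set (Fin k → ℝ), MeasurableSet S →
      M d S ≤ ENNReal.ofReal (Real.exp ε) * M d' S + ENNReal.ofReal δ := by
  intro d d' hA S hS
  have hSens := hsens d d' hA
  set r := Real.sqrt (∑ i, (q d i - q d' i) ^ 2) with hr
  have hr0 : 0 ≤ r := Real.sqrt_nonneg _
  have hsum0 : 0 ≤ ∑ i, (q d i - q d' i) ^ 2 := Finset.sum_nonneg fun i _ => sq_nonneg _
  have hr2 : r ^ 2 = ∑ i, (q d i - q d' i) ^ 2 := Real.sq_sqrt hsum0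
  rcases hr0.eq_or_lt with h0 | hrpos
  · have hq : q d = q d' := by
      have : ∑ i, (q d i - q d' i) ^ 2 = 0 := by rw [← hr2, ← h0]; ring
      rw [Finset.sum_eq_zero_iff_of_nonneg fun i _ => sq_nonneg _] at this
      ext i
      have := this i (Finset.mem_univ i)
      exact sub_eq_zero.1 (pow_eq_zero_iff two_ne_zero |>.1 this)
    have hMM : M d = M d' := by rw [hM, hM, hq]
    rw [hMM]
    refine le_add_right (le_mul_of_one_le_left zero_le ?_)
    rw [← ENNReal.ofReal_one]
    exact ENNReal.ofReal_le_ofReal (Real.one_le_exp hε.le)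
  -- main case
  set R := Real.sqrt (K ^ 2 + 2 * ε) with hR
  have hRpos : 0 < R := Real.sqrt_pos.2 (by positivity)
  have hR2 : R ^ 2 = K ^ 2 + 2 * ε := Real.sq_sqrt (by positivity)
  have hσr : r * (K + R) ≤ 2 * ε * σ := by
    have h1 : r * (K + R) ≤ Δ * (K + R) := by gcongr
    have h2 : Δ * (K + R) = 2 * ε * (Δ / (2 * ε) * (K + R)) := by field_simp
    have h3 : 2 * ε * (Δ / (2 * ε) * (K + R)) ≤ 2 * ε * σ :=
      mul_le_mul_of_nonneg_left hσ (by positivity)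
    linarith
  have hσpos : 0 < σ := by
    have : 0 < r * (K + R) := by positivity
    by_contra hn
    nlinarith
  have hkey : K * (σ * r) ≤ ε * σ ^ 2 - r ^ 2 / 2 := by
    have h1 : r * R ≤ 2 * ε * σ - r * K := by linarith
    have h2 : (r * R) ^ 2 ≤ (2 * ε * σ - r * K) ^ 2 := by gcongr
    have h3 : (r * R) ^ 2 = r ^ 2 * (K ^ 2 + 2 * ε) := by rw [mul_pow, hR2]
    have h4 : 0 ≤ (4 * ε) * (ε * σ ^ 2 - r ^ 2 / 2 - K * (σ * r)) := by nlinarith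
    have := nonneg_of_mul_nonneg_right h4 (by positivity)
    linarith
  set V : NNReal := (σ ^ 2).toNNReal with hV
  have hVr : (V : ℝ) = σ ^ 2 := Real.coe_toNNReal _ (sq_nonneg _)
  have hV0 : V ≠ 0 := by
    rw [← NNReal.coe_ne_zero, hVr]; positivity
  have hMpi : ∀ e, M e = Measure.pi fun i => gaussianReal (q e i) V := by
    intro e
    rw [hM e]
    have := Measure.pi_map_pi (μ := fun _ : Fin k => gaussianReal 0 V)
      (f := fun i x => q e i + x) (hμ := fun i => by
        rw [gaussianReal_map_const_add]; infer_instance) (fun i => by fun_prop)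
    simp only [gaussianReal_map_const_add, zero_add] at this
    exact this
  set B : Set (Fin k → ℝ) :=
    {x | ∑ i, ((x i - q d' i) ^ 2 - (x i - q d i) ^ 2) / (2 * V) ≤ ε} with hB
  have hBm : MeasurableSet B := measurableSet_le (by fun_prop) (by fun_prop)
  have hgood : M d (S ∩ B) ≤ ENNReal.ofReal (Real.exp ε) * M d' S := by
    rw [hMpi d, hMpi d', gm_pi_withDensity _ _ _ (fun i => by fun_prop)
      (fun i => gm_density (q d i) (q d' i) V hV0), withDensity_apply _ (hS.inter hBm)]
    calc _ ≤ ∫⁻ _ in S ∩ B, ENNReal.ofReal (Real.exp ε)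
          ∂(Measure.pi fun i => gaussianReal (q d' i) V) := by
          refine setLIntegral_mono measurable_const fun x hx => ?_
          rw [← ENNReal.ofReal_prod_of_nonneg fun i _ => (Real.exp_pos _).le, ← Real.exp_sum]
          exact ENNReal.ofReal_le_ofReal (Real.exp_le_exp.2 hx.2)
      _ ≤ _ := by
          rw [setLIntegral_const]
          gcongr
          exact Set.inter_subset_left
  have hbad : M d Bᶜ ≤ ENNReal.ofReal δ := by
    rw [hM d, Measure.map_apply (by fun_prop) hBm.compl]
    have hsub : (fun w => q d + w) ⁻¹' Bᶜ ⊆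
        (fun w : Fin k → ℝ => ∑ i, (q d i - q d' i) * w i) ⁻¹'
          Set.Ioi (ε * σ ^ 2 - r ^ 2 / 2) := by
      intro w hw
      simp only [hB, Set.mem_preimage, Set.mem_compl_iff, Set.mem_setOf_eq, not_le,
        Pi.add_apply, Set.mem_Ioi] at hw ⊢
      rw [← Finset.sum_div, hVr, lt_div_iff₀ (by positivity)] at hw
      have : ∑ i, ((q d i + w i - q d' i) ^ 2 - (q d i + w i - q d i) ^ 2)
          = 2 * ∑ i, (q d i - q d' i) * w i + r ^ 2 := by
        rw [hr2, Finset.mul_sum, ← Finset.sum_add_distrib]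
        exact Finset.sum_congr rfl fun i _ => by ring
      rw [this] at hw
      linarith
    refine (measure_mono hsub).trans ?_
    rw [← Measure.map_apply (by fun_prop) measurableSet_Ioi, gm_sum_law]
    have : (∑ i, (q d i - q d' i) ^ 2) * (V : ℝ) = (σ * r) ^ 2 := by
      rw [hVr, ← hr2]; ring
    rw [this]
    exact gm_tail (σ * r) _ K δ (by positivity) hkey hQK
  calc M d S ≤ M d (S ∩ B) + M d Bᶜ := by
        refine (measure_mono ?_).trans (measure_union_le _ _)
        intro x hx
        by_cases hxB : x ∈ B
        · exact Or.inl ⟨hx, hxB⟩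
        · exact Or.inr hxB
    _ ≤ _ := add_le_add hgood hbad
end

section
/- Gaussian shift-tail inequality: let σ > 0, ε ≥ 0, let v ∈ ℝ^k with v ≠ 0, and let γ be the centered Gaussian measure on ℝ^k with covariance σ² I_k (i.i.d. N(0,σ²) coordinates). Then for every Borel set S ⊆ ℝ^k, γ(S − v) ≤ e^ε · γ(S) + 𝒬( εσ/‖v‖₂ − ‖v‖₂/(2σ) ), where γ(S − v) is the probability that v + w ∈ S for w distributed according to γ, and 𝒬(x) = (1/√(2π)) ∫ₓ^∞ e^{−u²/2} du. -/
open MeasureTheory ProbabilityTheory ENNReal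

/-- Law of a linear functional of i.i.d. Gaussians. -/
lemma map_linear_pi_gauss {k : ℕ} (s : NNReal) (a : Fin k → ℝ) (h : (s : ℝ) * ∑ i, a i ^ 2 = 1) :
    (Measure.pi fun _ : Fin k => gaussianReal 0 s).map (fun w => ∑ i, a i * w i)
      = gaussianReal 0 1 := by
  have hm : Measurable (fun w : Fin k → ℝ => ∑ i, a i * w i) := by fun_prop
  haveI : IsProbabilityMeasure ((Measure.pi fun _ : Fin k => gaussianReal 0 s).map
      (fun w => ∑ i, a i * w i)) := Measure.isProbabilityMeasure_map hm.aemeasurable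
  apply Measure.ext_of_charFun
  ext t
  rw [charFun_apply_real, integral_map hm.aemeasurable (by fun_prop)]
  have h1 : ∀ w : Fin k → ℝ, Complex.exp (t * ((∑ i, a i * w i : ℝ) : ℂ) * Complex.I)
      = ∏ i, Complex.exp (((t * a i : ℝ) : ℂ) * (w i : ℂ) * Complex.I) := by
    intro w
    rw [← Complex.exp_sum]
    push_cast
    rw [Finset.mul_sum, Finset.sum_mul]
    congr 1
    exact Finset.sum_congr rfl fun i _ => by ring
  simp_rw [h1]
  rw [integral_fintype_prod_eq_prod
    (f := fun i (x : ℝ) => Complex.exp (((t * a i : ℝ) : ℂ) * (x : ℂ) * Complex.I))]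
  simp_rw [← charFun_apply_real, charFun_gaussianReal]
  rw [← Complex.exp_sum]
  congr 1
  have h2 : (s : ℂ) * ∑ i, (a i : ℂ) ^ 2 = 1 := by exact_mod_cast h
  have h3 : ∀ i, ((t * a i : ℝ) : ℂ) * ((0 : ℝ) : ℂ) * Complex.I
      - ((s : ℝ) : ℂ) * ((t * a i : ℝ) : ℂ) ^ 2 / 2
      = (-(t : ℂ) ^ 2 / 2 * s) * (a i : ℂ) ^ 2 := by
    intro i; push_cast; ring
  rw [Finset.sum_congr rfl fun i _ => h3 i, ← Finset.mul_sum, mul_assoc, h2]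
  push_cast; ring

/-- One-dimensional Cameron-Martin. -/
lemma gauss_shift_one (s : NNReal) (hs : s ≠ 0) (m : ℝ) :
    (gaussianReal 0 s).map (fun x => m + x) = (gaussianReal 0 s).withDensity
      (fun x => ENNReal.ofReal (Real.exp (m * x / s - m ^ 2 / (2 * s)))) := by
  rw [gaussianReal_map_const_add, gaussianReal_of_var_ne_zero _ hs,
    gaussianReal_of_var_ne_zero _ hs, ← withDensity_mul _ (by fun_prop) (by fun_prop)]
  congr 1
  ext x
  have hs' : (s : ℝ) ≠ 0 := by exact_mod_cast hs
  simp only [Pi.mul_apply, gaussianPDF]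
  rw [← ENNReal.ofReal_mul (gaussianPDFReal_nonneg _ _ _)]
  congr 1
  simp only [gaussianPDFReal]
  rw [mul_assoc (Real.sqrt _)⁻¹, ← Real.exp_add]
  congr 2
  field_simp
  ring

/-- Cameron-Martin for product Gaussians. -/
lemma gauss_shift_pi {k : ℕ} (s : NNReal) (hs : s ≠ 0) (v : Fin k → ℝ) :
    (Measure.pi fun _ : Fin k => gaussianReal 0 s).map (fun w => v + w)
      = (Measure.pi fun _ : Fin k => gaussianReal 0 s).withDensity
      (fun x => ∏ i, ENNReal.ofReal (Real.exp (v i * x i / s - v i ^ 2 / (2 * s)))) := by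
  have h1 : (Measure.pi fun _ : Fin k => gaussianReal 0 s).map (fun w => v + w)
      = Measure.pi (fun i => (gaussianReal 0 s).map (fun x => v i + x)) := by
    haveI : ∀ i, IsProbabilityMeasure ((gaussianReal 0 s).map (fun x => v i + x)) :=
      fun i => Measure.isProbabilityMeasure_map (by fun_prop)
    exact (Measure.pi_map_pi (μ := fun _ : Fin k => gaussianReal 0 s)
      (f := fun i x => v i + x) (fun i => by fun_prop)).symm ▸ rfl
  rw [h1]
  haveI : ∀ i, IsProbabilityMeasure ((gaussianReal 0 s).map (fun x => v i + x)) :=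
      fun i => Measure.isProbabilityMeasure_map (by fun_prop)
  refine (Measure.pi_eq fun t ht => ?_)
  have hpt : MeasurableSet (Set.univ.pi t) := MeasurableSet.univ_pi ht
  rw [withDensity_apply _ hpt, ← lintegral_indicator hpt]
  set f : Fin k → ℝ → ℝ≥0∞ := fun i => (t i).indicator
    (fun x => ENNReal.ofReal (Real.exp (v i * x / s - v i ^ 2 / (2 * s)))) with hf
  have hfm : ∀ i, Measurable (f i) := fun i => Measurable.indicator (by fun_prop) (ht i)
  have h2 : ∀ x : Fin k → ℝ, (Set.univ.pi t).indicator
      (fun x => ∏ i, ENNReal.ofReal (Real.exp (v i * x i / s - v i ^ 2 / (2 * s)))) x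
      = ∏ i, f i (x i) := by
    intro x
    by_cases hx : x ∈ Set.univ.pi t
    · rw [Set.indicator_of_mem hx]
      refine Finset.prod_congr rfl fun i _ => ?_
      rw [hf]; simp only
      rw [Set.indicator_of_mem (hx i (Set.mem_univ i))]
    · rw [Set.indicator_of_notMem hx]
      have : ∃ i, x i ∉ t i := by simpa [Set.mem_pi] using hx
      obtain ⟨i, hi⟩ := this
      exact (Finset.prod_eq_zero (Finset.mem_univ i) (Set.indicator_of_notMem hi _)).symm
  simp_rw [h2]
  rw [lintegral_prod_eq_prod_lintegral_of_indepFun Finset.univ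
    (fun i (x : Fin k → ℝ) => f i (x i))
    (iIndepFun_pi fun i => (hfm i).aemeasurable) (fun i => (hfm i).comp (measurable_pi_apply i))]
  refine Finset.prod_congr rfl fun i _ => ?_
  rw [gauss_shift_one s hs, withDensity_apply _ (ht i), ← lintegral_indicator (ht i)]
  exact (measurePreserving_eval (fun _ : Fin k => gaussianReal 0 s) i).lintegral_comp (hfm i)


/-- Gaussian shift-tail inequality: for `σ > 0`, `ε ≥ 0`, `v ≠ 0` and
`γ = N(0, σ² I_k)` on `ℝ^k`, for every Borel set `S`,
`γ {w | v + w ∈ S} ≤ e^ε γ(S) + 𝒬(εσ/‖v‖₂ − ‖v‖₂/(2σ))`. -/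
theorem gaussian_shift_tail
    {k : ℕ} (σ ε : ℝ) (hσ : 0 < σ) (hε : 0 ≤ ε)
    (v : Fin k → ℝ) (hv : v ≠ 0)
    (γ : Measure (Fin k → ℝ))
    (hγ : γ = Measure.pi fun _ : Fin k => gaussianReal 0 ((σ ^ 2).toNNReal))
    (S : Set (Fin k → ℝ)) (hS : MeasurableSet S) :
    γ {w | v + w ∈ S} ≤ ENNReal.ofReal (Real.exp ε) * γ S +
      ENNReal.ofReal ((1 / Real.sqrt (2 * Real.pi)) *
        ∫ u in Set.Ioi (ε * σ / Real.sqrt (∑ i, v i ^ 2)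
          - Real.sqrt (∑ i, v i ^ 2) / (2 * σ)), Real.exp (-u ^ 2 / 2)) := by
  set n := Real.sqrt (∑ i, v i ^ 2) with hn
  have hsum : 0 < ∑ i, v i ^ 2 := by
    obtain ⟨i, hi⟩ := Function.ne_iff.mp hv
    exact Finset.sum_pos' (fun i _ => sq_nonneg _) ⟨i, Finset.mem_univ i, by
      have : v i ≠ 0 := hi
      positivity⟩
  have hn0 : 0 < n := Real.sqrt_pos.mpr hsum
  have hn2 : ∑ i, v i ^ 2 = n ^ 2 := (Real.sq_sqrt hsum.le).symm
  have hs2 : 0 < σ ^ 2 := by positivity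
  set s := (σ ^ 2).toNNReal with hs
  have hs0 : s ≠ 0 := by simpa [hs] using hσ.ne'
  have hsσ : (s : ℝ) = σ ^ 2 := Real.coe_toNNReal _ hs2.le
  have hprod : ∀ x : Fin k → ℝ,
      ∏ i, ENNReal.ofReal (Real.exp (v i * x i / s - v i ^ 2 / (2 * s)))
      = ENNReal.ofReal (Real.exp ((∑ i, v i * x i) / σ ^ 2 - n ^ 2 / (2 * σ ^ 2))) := by
    intro x
    rw [← ENNReal.ofReal_prod_of_nonneg (fun i _ => (Real.exp_pos _).le), ← Real.exp_sum,
      Finset.sum_sub_distrib, ← Finset.sum_div, ← Finset.sum_div, hn2, hsσ]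
  have hshift := gauss_shift_pi s hs0 v
  simp_rw [hprod] at hshift
  rw [← hγ] at hshift
  have hmv : Measurable (fun w : Fin k → ℝ => v + w) := by fun_prop
  set T : Set (Fin k → ℝ) := {x | (∑ i, v i * x i) / σ ^ 2 - n ^ 2 / (2 * σ ^ 2) ≤ ε} with hT
  have hTm : MeasurableSet T := measurableSet_le (by fun_prop) measurable_const
  have e1 : γ {w | v + w ∈ S} = γ.map (fun w => v + w) S := (Measure.map_apply hmv hS).symm
  have e2 : γ.map (fun w => v + w) (S ∩ T) ≤ ENNReal.ofReal (Real.exp ε) * γ S := by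
    rw [hshift, withDensity_apply _ (hS.inter hTm)]
    calc _ ≤ ∫⁻ _ in S ∩ T, ENNReal.ofReal (Real.exp ε) ∂γ := by
          refine setLIntegral_mono measurable_const fun x hx => ?_
          exact ENNReal.ofReal_le_ofReal (Real.exp_le_exp.mpr hx.2)
      _ = ENNReal.ofReal (Real.exp ε) * γ (S ∩ T) := by rw [setLIntegral_const]
      _ ≤ _ := by gcongr; exact Set.inter_subset_left
  have e3 : γ.map (fun w => v + w) Tᶜ = ENNReal.ofReal ((1 / Real.sqrt (2 * Real.pi)) *
        ∫ u in Set.Ioi (ε * σ / n - n / (2 * σ)), Real.exp (-u ^ 2 / 2)) := by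
    have hlaw := map_linear_pi_gauss s (fun i => v i / (σ * n)) (by
      simp_rw [div_pow]
      rw [← Finset.sum_div, hn2, hsσ]
      field_simp)
    rw [← hγ] at hlaw
    rw [Measure.map_apply hmv hTm.compl]
    have : (fun w => v + w) ⁻¹' Tᶜ = (fun w : Fin k → ℝ => ∑ i, v i / (σ * n) * w i) ⁻¹'
        Set.Ioi (ε * σ / n - n / (2 * σ)) := by
      ext w
      have q1 : ∑ i, v i * (v + w) i = n ^ 2 + ∑ i, v i * w i := by
        rw [← hn2, ← Finset.sum_add_distrib]
        exact Finset.sum_congr rfl fun i _ => by simp only [Pi.add_apply]; ring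
      have q2 : ∑ i, v i / (σ * n) * w i = (∑ i, v i * w i) / (σ * n) := by
        rw [Finset.sum_div]
        exact Finset.sum_congr rfl fun i _ => by ring
      simp only [hT, Set.mem_preimage, Set.mem_compl_iff, Set.mem_setOf_eq, Set.mem_Ioi, not_le]
      rw [q1, q2]
      generalize (∑ i, v i * w i) = c
      have r1 : c / (σ * n) - (ε * σ / n - n / (2 * σ)) =
          (σ / n) * ((n ^ 2 + c) / σ ^ 2 - n ^ 2 / (2 * σ ^ 2) - ε) := by
        field_simp; ring
      rw [← sub_pos, ← sub_pos (a := c / (σ * n)), r1]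
      exact (mul_pos_iff_of_pos_left (by positivity)).symm
    rw [this, ← Measure.map_apply (by fun_prop) measurableSet_Ioi, hlaw,
      gaussianReal_apply_eq_integral _ one_ne_zero, ← integral_const_mul]
    congr 1
    refine integral_congr_ae (ae_of_all _ fun x => ?_)
    simp [gaussianPDFReal]
  rw [e1, ← e3]
  calc γ.map (fun w => v + w) S
      ≤ γ.map (fun w => v + w) ((S ∩ T) ∪ Tᶜ) := by
        apply measure_mono
        intro x hx
        by_cases h : x ∈ T
        · exact Or.inl ⟨hx, h⟩
        · exact Or.inr h
    _ ≤ _ := measure_union_le _ _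
    _ ≤ _ := by gcongr
end

section
/- Finite-time criterion for differential privacy: let D be a set with a symmetric adjacency relation Adj, and let M be a mechanism assigning to each u ∈ D a probability measure M(u) on the sequence space (ℝ^m)^ℕ equipped with the product (cylinder) σ-algebra. For T ∈ ℕ let π_T : (ℝ^m)^ℕ → (ℝ^m)^{T+1} denote the projection x ↦ (x₀, …, x_T). Then the following are equivalent: (a) M is (ε,δ)-differentially private, i.e. M(u)(H) ≤ e^ε · M(u')(H) + δ for all adjacent u, u' and all measurable H ⊆ (ℝ^m)^ℕ; (b) for all adjacent u, u', all T ∈ ℕ, and all Borel sets A ⊆ (ℝ^m)^{T+1}, (M(u)).map(π_T)(A) ≤ e^ε · (M(u')).map(π_T)(A) + δ, where .map denotes the pushforward measure. -/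
open MeasureTheory ENNReal

/-- finite-time criterion for differential privacy: a mechanism with
values in probability measures on the sequence space `(ℝ^m)^ℕ` (with the product
σ-algebra) is `(ε,δ)`-differentially private iff all its finite-dimensional projections
satisfy the `(ε,δ)`-differential privacy inequality. -/
theorem dp_iff_finite_time_dp
    {D : Type*} {m : ℕ}
    (Adj : D → D → Prop) (hAdjSymm : Symmetric Adj)
    (M : D → Measure (ℕ → Fin m → ℝ)) (hprob : ∀ u, IsProbabilityMeasure (M u))
    (ε δ : ℝ) (hε : 0 ≤ ε) (hδ : 0 ≤ δ) :
    (∀ u u', Adj u u' → ∀ H : Set (ℕ → Fin m → ℝ), MeasurableSet H →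
        M u H ≤ ENNReal.ofReal (Real.exp ε) * M u' H + ENNReal.ofReal δ)
    ↔
    (∀ u u', Adj u u' → ∀ T : ℕ, ∀ A : Set (Fin (T + 1) → Fin m → ℝ),
        MeasurableSet A →
        (M u).map (fun x (i : Fin (T + 1)) => x i) A ≤
          ENNReal.ofReal (Real.exp ε) *
            (M u').map (fun x (i : Fin (T + 1)) => x i) A + ENNReal.ofReal δ) := by
  have hmeas : ∀ T : ℕ, Measurable
      (fun (x : ℕ → Fin m → ℝ) (i : Fin (T + 1)) => x i) := fun T =>
    measurable_pi_lambda _ fun i => measurable_pi_apply _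
  constructor
  · intro h u u' hu T A hA
    rw [Measure.map_apply (hmeas T) hA, Measure.map_apply (hmeas T) hA]
    exact h u u' hu _ (hmeas T hA)
  · intro h u u' hu H hH
    have hcyl : ∀ t ∈ measurableCylinders (fun _ : ℕ => Fin m → ℝ),
        M u t ≤ ENNReal.ofReal (Real.exp ε) * M u' t + ENNReal.ofReal δ := by
      intro t ht
      rw [measurableCylinders_nat] at ht
      simp only [Set.mem_iUnion, Set.mem_singleton_iff] at ht
      obtain ⟨T, S, hS, rfl⟩ := ht
      let g : (Fin (T + 1) → Fin m → ℝ) → ((i : Finset.Iic T) → Fin m → ℝ) :=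
        fun y i => y ⟨i.1, Nat.lt_succ_of_le (Finset.mem_Iic.mp i.2)⟩
      have hg : Measurable g := measurable_pi_lambda _ fun i => measurable_pi_apply _
      have key := h u u' hu T (g ⁻¹' S) (hg hS)
      rw [Measure.map_apply (hmeas T) (hg hS), Measure.map_apply (hmeas T) (hg hS)] at key
      exact key
    have := hprob u
    have := hprob u'
    apply ENNReal.le_of_forall_pos_le_add
    intro ζ hζ _
    set c : NNReal := (Real.exp ε).toNNReal with hc
    have hη : 0 < ζ / (c + 1) := by positivity
    obtain ⟨t, htC, ht⟩ := exists_measure_symmDiff_lt_of_generateFrom_isSetRing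
      (μ := M u + M u') isSetRing_measurableCylinders
      ⟨{Set.univ}, Set.countable_singleton _,
        Set.singleton_subset_iff.mpr (univ_mem_measurableCylinders _), by simp⟩
      generateFrom_measurableCylinders.symm hH
      (ε := ((ζ / (c + 1) : NNReal) : ENNReal)) (by exact_mod_cast hη)
    rw [Measure.add_apply] at ht
    have h1 : M u H ≤ M u t + (ζ / (c + 1) : NNReal) := by
      have hs : H ⊆ t ∪ symmDiff t H := by
        intro x hx
        by_cases hxt : x ∈ t
        · exact Or.inl hxt
        · exact Or.inr (Or.inr ⟨hx, hxt⟩)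
      refine (measure_mono hs).trans ((measure_union_le _ _).trans ?_)
      gcongr
      exact le_self_add.trans ht.le
    have h2 : M u' t ≤ M u' H + (ζ / (c + 1) : NNReal) := by
      have hs : t ⊆ H ∪ symmDiff t H := by
        intro x hx
        by_cases hxt : x ∈ H
        · exact Or.inl hxt
        · exact Or.inr (Or.inl ⟨hx, hxt⟩)
      refine (measure_mono hs).trans ((measure_union_le _ _).trans ?_)
      gcongr
      exact le_add_self.trans ht.le
    have h3 : (c : ENNReal) * (ζ / (c + 1) : NNReal) + (ζ / (c + 1) : NNReal) = ζ := by
      norm_cast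
      field_simp
    calc M u H ≤ M u t + (ζ / (c + 1) : NNReal) := h1
      _ ≤ (c * M u' t + ENNReal.ofReal δ) + (ζ / (c + 1) : NNReal) := by
          gcongr
          exact hcyl t htC
      _ ≤ (c * (M u' H + (ζ / (c + 1) : NNReal)) + ENNReal.ofReal δ)
            + (ζ / (c + 1) : NNReal) := by gcongr
      _ = c * M u' H + ENNReal.ofReal δ
            + (c * (ζ / (c + 1) : NNReal) + (ζ / (c + 1) : NNReal)) := by ring
      _ = c * M u' H + ENNReal.ofReal δ + ζ := by rw [h3]
end

section
/- Sensitivity of a sum of systems with bounded incremental gains: for 1 ≤ i ≤ n let 𝒢ᵢ be a map from sequences uᵢ : ℕ → ℝ^{mᵢ} to sequences ℕ → ℝ^{m'}, let α ∈ {1,2}, let rᵢ ∈ [1,∞], and suppose each 𝒢ᵢ has ℓ_{rᵢ}-to-ℓ_α incremental gain at most γᵢ, i.e. for all inputs v, v' and all T ∈ ℕ, ( Σ_{t=0}^{T} ‖(𝒢ᵢv)_t − (𝒢ᵢv')_t‖_α^α )^{1/α} ≤ γᵢ · ‖P_T(v − v')‖_{rᵢ}, where P_T truncates a sequence to its first T+1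 terms (zero afterwards). Define 𝒢(u₁,…,u_n) = Σᵢ 𝒢ᵢ uᵢ. Fix b₁,…,b_n ≥ 0 and suppose u = (u₁,…,u_n) and u' = (u'₁,…,u'_n) are adjacent in the sense Adj^b: there is an index i with u_j = u'_j for all j ≠ i and ‖uᵢ − u'ᵢ‖_{rᵢ} ≤ bᵢ. Then for all T ∈ ℕ, ( Σ_{t=0}^{T} ‖(𝒢u)_t − (𝒢u')_t‖_α^α )^{1/α} ≤ max_{1 ≤ j ≤ n} γⱼ bⱼ. -/
open MeasureTheory ENNReal

/-- The ℓ_r norm (with `r ∈ [1,∞]`, possibly `∞`) of a vector-valued sequence,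
`‖v‖_r = (Σ_t Σ_j |v_{t,j}|^r)^{1/r}` for finite `r` and `sup_{t,j} |v_{t,j}|` for
`r = ∞`, realized as the `L^r` seminorm w.r.t. counting measure. -/
noncomputable def seqLpNorm {p : ℕ} (r : ℝ≥0∞) (v : ℕ → Fin p → ℝ) : ℝ≥0∞ :=
  eLpNorm (fun x : ℕ × Fin p => v x.1 x.2) r Measure.count

/-- Truncation operator `P_T`: keeps the first `T+1` terms of a sequence, zero after. -/
def seqTrunc {p : ℕ} (T : ℕ) (v : ℕ → Fin p → ℝ) : ℕ → Fin p → ℝ :=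
  fun t => if t ≤ T then v t else 0

/-- `(Σ_{t=0}^{T} ‖w_t‖_α^α)^{1/α}` for `α ∈ {1,2}`, where `‖·‖_α` is the ℓ_α norm
on `ℝ^{m'}` (so `‖w_t‖_α^α = Σ_j |w_{t,j}|^α`). -/
noncomputable def truncLaNorm {p : ℕ} (α : ℝ) (T : ℕ) (w : ℕ → Fin p → ℝ) : ℝ :=
  (∑ t ∈ Finset.range (T + 1), ∑ j, |w t j| ^ α) ^ (1 / α)

/-- if each system `𝒢ᵢ` has ℓ_{rᵢ}-to-ℓ_α incremental gain at most `γᵢ`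
(`α ∈ {1,2}`), then for inputs `u, u'` adjacent w.r.t. `Adj^b` (differing only in one
component `i`, with `‖uᵢ − u'ᵢ‖_{rᵢ} ≤ bᵢ`), the truncated ℓ_α norm of
`𝒢u − 𝒢u'`, where `𝒢u = Σᵢ 𝒢ᵢuᵢ`, is bounded by `max_j γⱼ bⱼ` for every `T`. -/
theorem sensitivity_of_sum_of_systems
    {n : ℕ} {m : Fin n → ℕ} {m' : ℕ}
    (G : (i : Fin n) → (ℕ → Fin (m i) → ℝ) → (ℕ → Fin m' → ℝ))
    (α : ℝ) (hα : α = 1 ∨ α = 2)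
    (r : Fin n → ℝ≥0∞) (hr : ∀ i, 1 ≤ r i)
    (γ b : Fin n → ℝ) (hγ : ∀ i, 0 ≤ γ i) (hb : ∀ i, 0 ≤ b i)
    (hgain : ∀ i (v v' : ℕ → Fin (m i) → ℝ) (T : ℕ),
      ENNReal.ofReal (truncLaNorm α T (fun t j => G i v t j - G i v' t j)) ≤
        ENNReal.ofReal (γ i) * seqLpNorm (r i) (seqTrunc T (fun t j => v t j - v' t j)))
    (u u' : (i : Fin n) → ℕ → Fin (m i) → ℝ)
    (hadj : ∃ i, (∀ j, j ≠ i → u j = u' j) ∧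
      seqLpNorm (r i) (fun t j => u i t j - u' i t j) ≤ ENNReal.ofReal (b i)) :
    ∀ T : ℕ,
      ENNReal.ofReal (truncLaNorm α T
          (fun t j => (∑ i, G i (u i) t j) - ∑ i, G i (u' i) t j)) ≤
        ⨆ i : Fin n, ENNReal.ofReal (γ i * b i) := by
  obtain ⟨i, hne, hi⟩ := hadj
  intro T
  have hfun : (fun (t : ℕ) (j : Fin m') => (∑ k, G k (u k) t j) - ∑ k, G k (u' k) t j) =
      fun t j => G i (u i) t j - G i (u' i) t j := by
    funext t j
    rw [← Finset.sum_sub_distrib]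
    refine Finset.sum_eq_single i ?_ ?_
    · intro k _ hk
      rw [hne k hk, sub_self]
    · intro h
      exact absurd (Finset.mem_univ i) h
  rw [hfun]
  have hmono : seqLpNorm (r i) (seqTrunc T (fun t j => u i t j - u' i t j)) ≤
      seqLpNorm (r i) (fun t j => u i t j - u' i t j) := by
    unfold seqLpNorm
    refine eLpNorm_mono ?_
    rintro ⟨t, j⟩
    by_cases h : t ≤ T
    · simp [seqTrunc, h]
    · simp [seqTrunc, h]
  calc _ ≤ ENNReal.ofReal (γ i) *
        seqLpNorm (r i) (seqTrunc T (fun t j => u i t j - u' i t j)) := hgain i _ _ T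
    _ ≤ ENNReal.ofReal (γ i) * ENNReal.ofReal (b i) := by
        gcongr
        exact hmono.trans hi
    _ = ENNReal.ofReal (γ i * b i) := (ENNReal.ofReal_mul (hγ i)).symm
    _ ≤ _ := le_iSup (fun k => ENNReal.ofReal (γ k * b k)) i
end

section
/- Dynamic Laplace mechanism: for 1 ≤ i ≤ n let 𝒢ᵢ map sequences ℕ → ℝ^{mᵢ} to sequences ℕ → ℝ^{m'}, with ℓ_{rᵢ}-to-ℓ₁ incremental gain at most γᵢ (for all v, v' and T: Σ_{t=0}^{T} ‖(𝒢ᵢv)_t − (𝒢ᵢv')_t‖₁ ≤ γᵢ ‖P_T(v−v')‖_{rᵢ}), and set 𝒢(u₁,…,u_n) = Σᵢ 𝒢ᵢuᵢ. Let ε > 0 and B ≥ max_{1≤i≤n} γᵢ bᵢ. Define the mechanism M by letting M(u) be the law of 𝒢u + w on the sequence space (ℝ^{m'})^ℕ with its product σ-algebra, where w is an i.i.d. noise sequence whose entries (over time t and over the m' coordinates) are independent Laplace random variables with density x ↦ (ε/(2B)) exp(−ε|x|/B); that is, M(u) is the pushforward of the countable product of these Laplace measures under w ↦ 𝒢u +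 w. Then M is ε-differentially private for the adjacency relation Adj^b: for adjacent u, u' and all measurable H, M(u)(H) ≤ e^ε · M(u')(H). -/
open MeasureTheory ENNReal

/-- The Laplace probability measure on `ℝ` with scale `B/ε`,
with density `x ↦ (ε/(2B)) exp(−ε|x|/B)` w.r.t. Lebesgue measure. -/
noncomputable def laplaceMeasure (B ε : ℝ) : Measure ℝ :=
  volume.withDensity (fun x => ENNReal.ofReal (ε / (2 * B) * Real.exp (-(ε * |x|) / B)))

open scoped symmDiff NNReal in
/-- Domination on a generating ring of sets extends to all measurable sets. -/
lemma le_of_le_on_ring {α : Type*} {mα : MeasurableSpace α} (μ ν : Measure α)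
    [IsFiniteMeasure μ] [IsFiniteMeasure ν] (K : ℝ≥0) {C : Set (Set α)} (hC : IsSetRing C)
    (hun : Set.univ ∈ C) (hgen : mα = MeasurableSpace.generateFrom C)
    (h : ∀ A ∈ C, μ A ≤ K * ν A) (s : Set α) (hs : MeasurableSet s) : μ s ≤ K * ν s := by
  have key : ∀ δ : ℝ≥0, 0 < δ → μ s ≤ K * ν s + (K + 1) * δ := by
    intro δ hδ
    obtain ⟨t, htC, ht⟩ := exists_measure_symmDiff_lt_of_generateFrom_isSetRing
      (μ := μ + ν) hC ⟨{Set.univ}, by simp, by simpa using hun, by simp⟩ hgen hs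
      (ε := δ) (by exact_mod_cast hδ)
    rw [Measure.add_apply] at ht
    have h1 : μ (t ∆ s) ≤ δ := le_trans le_self_add ht.le
    have h2 : ν (t ∆ s) ≤ δ := le_trans le_add_self ht.le
    have e1 : s ⊆ t ∪ (t ∆ s) := by
      intro x hx
      by_cases hxt : x ∈ t
      · exact Or.inl hxt
      · exact Or.inr (Or.inr ⟨hx, hxt⟩)
    have e2 : t ⊆ s ∪ (t ∆ s) := by
      intro x hx
      by_cases hxt : x ∈ s
      · exact Or.inl hxt
      · exact Or.inr (Or.inl ⟨hx, hxt⟩)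
    calc μ s ≤ μ t + μ (t ∆ s) := (measure_mono e1).trans (measure_union_le _ _)
      _ ≤ K * ν t + δ := add_le_add (h t htC) h1
      _ ≤ K * (ν s + δ) + δ := by
        gcongr
        exact ((measure_mono e2).trans (measure_union_le _ _)).trans (by gcongr)
      _ = K * ν s + (K + 1) * δ := by ring
  refine ENNReal.le_of_forall_pos_le_add ?_
  intro η hη _
  have := key (η / (K + 1)) (by positivity)
  refine this.trans (le_of_eq ?_)
  congr 1
  have : (K + 1) * (η / (K + 1)) = η := by field_simp
  exact_mod_cast this

open scoped NNReal in
lemma pi_le_smul_pi {ι : Type*} [Fintype ι] {α : ι → Type*} [∀ i, MeasurableSpace (α i)]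
    (μ ν : ∀ i, Measure (α i)) [∀ i, SigmaFinite (μ i)] [∀ i, SigmaFinite (ν i)]
    (c : ι → ℝ≥0) (h : ∀ i, μ i ≤ c i • ν i) :
    Measure.pi μ ≤ (∏ i, c i) • Measure.pi ν := by
  have e : Measure.pi (fun i => c i • ν i) = (∏ i, c i) • Measure.pi ν := by
    refine Measure.pi_eq ?_
    intro s hs
    simp only [Measure.smul_apply, Measure.pi_pi]
    simp [ENNReal.smul_def, Finset.prod_mul_distrib]
  rw [← e]
  refine Measure.le_iff.2 fun s hs => ?_
  simp only [Measure.pi]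
  rw [toMeasure_apply _ _ hs, toMeasure_apply _ _ hs]
  have : OuterMeasure.pi (fun i => (μ i).toOuterMeasure) ≤
      OuterMeasure.pi (fun i => (c i • ν i).toOuterMeasure) := by
    rw [OuterMeasure.le_pi]
    intro s _
    refine (OuterMeasure.pi_pi_le _ _).trans ?_
    exact Finset.prod_le_prod' fun i _ => h i (s i)
  exact this s

instance laplaceMeasure_sigmaFinite (B ε : ℝ) : SigmaFinite (laplaceMeasure B ε) := by
  unfold laplaceMeasure
  exact SigmaFinite.withDensity_ofReal _

lemma map_add_laplace (B ε a : ℝ) : (laplaceMeasure B ε).map (fun x => a + x) =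
    volume.withDensity
      (fun x => ENNReal.ofReal (ε / (2 * B) * Real.exp (-(ε * |x - a|) / B))) := by
  ext s hs
  have hm : Measurable (fun x : ℝ => a + x) := by fun_prop
  rw [Measure.map_apply hm hs, laplaceMeasure, withDensity_apply _ (hm hs),
    withDensity_apply _ hs, ← lintegral_indicator (hm hs), ← lintegral_indicator hs,
    ← lintegral_add_left_eq_self (s.indicator _) a]
  congr 1
  ext x
  simp only [Set.indicator, add_sub_cancel_left]
  by_cases h : a + x ∈ s
  · rw [if_pos h, if_pos (show x ∈ (fun x => a + x) ⁻¹' s from h)]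
  · rw [if_neg h, if_neg (show x ∉ (fun x => a + x) ⁻¹' s from h)]

instance map_add_laplace_sigmaFinite (B ε a : ℝ) :
    SigmaFinite ((laplaceMeasure B ε).map (fun x => a + x)) := by
  rw [map_add_laplace]
  exact SigmaFinite.withDensity_ofReal _

lemma map_add_laplace_le (B ε a a' : ℝ) (hB : 0 ≤ B) (hε : 0 < ε) :
    (laplaceMeasure B ε).map (fun x => a + x) ≤
      (Real.exp (ε / B * |a - a'|)).toNNReal • (laplaceMeasure B ε).map (fun x => a' + x) := by
  rw [map_add_laplace, map_add_laplace]
  have : ∀ (c : NNReal) (f : ℝ → ℝ≥0∞), Measurable f →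
      c • volume.withDensity f = volume.withDensity (fun x => (c : ℝ≥0∞) * f x) := by
    intro c f hf
    rw [show c • volume.withDensity f = (c : ℝ≥0∞) • volume.withDensity f from rfl,
      ← withDensity_smul _ hf]
    rfl
  rw [this _ _ (by fun_prop)]
  refine withDensity_mono (Filter.Eventually.of_forall fun x => ?_)
  change ENNReal.ofReal _ ≤ ENNReal.ofReal (Real.exp _) * ENNReal.ofReal _
  rw [← ENNReal.ofReal_mul (Real.exp_pos _).le]
  refine ENNReal.ofReal_le_ofReal ?_
  rw [mul_left_comm, ← Real.exp_add]
  gcongr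
  rw [div_mul_eq_mul_div, ← add_div]
  gcongr
  have : |x - a'| ≤ |x - a| + |a - a'| := abs_sub_le _ _ _
  nlinarith

lemma pi_map_laplace_le {m' : ℕ} (N : ℕ) (B ε : ℝ) (g g' : ℕ → Fin m' → ℝ)
    (hB : 0 ≤ B) (hε : 0 < ε)
    (hd : ∑ t ∈ Finset.range N, ∑ j, |g t j - g' t j| ≤ B) :
    (Measure.pi (fun _ : Fin N => Measure.pi (fun _ : Fin m' => laplaceMeasure B ε))).map
      (fun w (t : Fin N) j => g t j + w t j) ≤
    (Real.exp ε).toNNReal •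
    (Measure.pi (fun _ : Fin N => Measure.pi (fun _ : Fin m' => laplaceMeasure B ε))).map
      (fun w (t : Fin N) j => g' t j + w t j) := by
  have inner : ∀ (g : ℕ → Fin m' → ℝ) (t : ℕ),
      (Measure.pi (fun _ : Fin m' => laplaceMeasure B ε)).map (fun w j => g t j + w j) =
      Measure.pi (fun j => (laplaceMeasure B ε).map (fun x => g t j + x)) := by
    intro g t
    exact Measure.pi_map_pi (f := fun j x => g t j + x) (fun j => by fun_prop)
  have : ∀ (g : ℕ → Fin m' → ℝ) (t : ℕ), SigmaFinite
      ((Measure.pi (fun _ : Fin m' => laplaceMeasure B ε)).map (fun w j => g t j + w j)) := by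
    intro g t
    rw [inner]
    infer_instance
  have outer : ∀ g : ℕ → Fin m' → ℝ,
      (Measure.pi (fun _ : Fin N => Measure.pi (fun _ : Fin m' => laplaceMeasure B ε))).map
        (fun w (t : Fin N) j => g t j + w t j) =
      Measure.pi (fun t : Fin N =>
        (Measure.pi (fun _ : Fin m' => laplaceMeasure B ε)).map (fun w j => g t j + w j)) := by
    intro g
    exact Measure.pi_map_pi (f := fun (t : Fin N) (w : Fin m' → ℝ) j => g t j + w j)
      (fun t => Measurable.aemeasurable (by fun_prop))
  rw [outer, outer]
  refine (pi_le_smul_pi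
    (fun t : Fin N => (Measure.pi (fun _ : Fin m' => laplaceMeasure B ε)).map
      (fun w j => g t j + w j))
    (fun t : Fin N => (Measure.pi (fun _ : Fin m' => laplaceMeasure B ε)).map
      (fun w j => g' t j + w j))
    (fun t : Fin N => ∏ j, (Real.exp (ε / B * |g t j - g' t j|)).toNNReal)
    ?_).trans ?_
  · intro t
    rw [inner, inner]
    exact pi_le_smul_pi (fun j => (laplaceMeasure B ε).map (fun x => g t j + x))
      (fun j => (laplaceMeasure B ε).map (fun x => g' t j + x)) _ fun j => map_add_laplace_le B ε _ _ hB hε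
  · have hc : ∏ t : Fin N, ∏ j, (Real.exp (ε / B * |g t j - g' t j|)).toNNReal ≤
        (Real.exp ε).toNNReal := by
      rw [← NNReal.coe_le_coe]
      push_cast
      simp only [Real.coe_toNNReal _ (Real.exp_pos _).le, ← Real.exp_sum]
      rw [Real.exp_le_exp]
      simp only [← Finset.mul_sum]
      rw [Fin.sum_univ_eq_sum_range (fun t => ∑ j, |g t j - g' t j|) N]
      rcases hB.eq_or_lt with h0 | h0
      · rw [← h0]; simpa using hε.le
      · calc _ ≤ ε / B * B := by gcongr
          _ = ε := by field_simp
    refine Measure.le_iff.2 fun s _ => ?_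
    simp only [Measure.smul_apply, ENNReal.smul_def, smul_eq_mul]
    gcongr

lemma seqLpNorm_trunc_le {p : ℕ} (r : ℝ≥0∞) (T : ℕ) (v : ℕ → Fin p → ℝ) :
    seqLpNorm r (seqTrunc T v) ≤ seqLpNorm r v := by
  unfold seqLpNorm
  refine eLpNorm_mono fun x => ?_
  unfold seqTrunc
  split_ifs <;> simp

/-- dynamic Laplace mechanism: if each `𝒢ᵢ` has ℓ_{rᵢ}-to-ℓ₁ incremental
gain at most `γᵢ`, `ε > 0` and `B ≥ max_i γᵢbᵢ`, then the mechanism `M u = law of 𝒢u + w`,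
where `w` is i.i.d. Laplace noise of scale `B/ε` over all times and coordinates (i.e. the
noise law `W` is the countable product of `Lap(B/ε)` measures, characterized by its
finite-dimensional marginals), is `ε`-differentially private for `Adj^b`. -/
theorem dynamic_laplace_mechanism_dp
    {n : ℕ} {m : Fin n → ℕ} {m' : ℕ}
    (G : (i : Fin n) → (ℕ → Fin (m i) → ℝ) → (ℕ → Fin m' → ℝ))
    (r : Fin n → ℝ≥0∞) (hr : ∀ i, 1 ≤ r i)
    (γ b : Fin n → ℝ) (hγ : ∀ i, 0 ≤ γ i) (hb : ∀ i, 0 ≤ b i)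
    (hgain : ∀ i (v v' : ℕ → Fin (m i) → ℝ) (T : ℕ),
      ENNReal.ofReal (∑ t ∈ Finset.range (T + 1), ∑ j, |G i v t j - G i v' t j|) ≤
        ENNReal.ofReal (γ i) * seqLpNorm (r i) (seqTrunc T (fun t j => v t j - v' t j)))
    (ε B : ℝ) (hε : 0 < ε) (hB : ∀ i, γ i * b i ≤ B)
    (W : Measure (ℕ → Fin m' → ℝ)) (hWprob : IsProbabilityMeasure W)
    (hW : ∀ T : ℕ, W.map (fun w (i : Fin (T + 1)) => w i) =
      Measure.pi (fun _ : Fin (T + 1) => Measure.pi (fun _ : Fin m' => laplaceMeasure B ε)))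
    (M : ((i : Fin n) → ℕ → Fin (m i) → ℝ) → Measure (ℕ → Fin m' → ℝ))
    (hM : ∀ u, M u = W.map (fun w t j => (∑ i, G i (u i) t j) + w t j)) :
    ∀ u u', (∃ i, (∀ j, j ≠ i → u j = u' j) ∧
        seqLpNorm (r i) (fun t j => u i t j - u' i t j) ≤ ENNReal.ofReal (b i)) →
      ∀ H : Set (ℕ → Fin m' → ℝ), MeasurableSet H →
        M u H ≤ ENNReal.ofReal (Real.exp ε) * M u' H := by
  rintro u u' ⟨i, hne, hi⟩ H hH
  have hB0 : 0 ≤ B := (mul_nonneg (hγ i) (hb i)).trans (hB i)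
  set g : ((i : Fin n) → ℕ → Fin (m i) → ℝ) → ℕ → Fin m' → ℝ :=
    fun u t j => ∑ i, G i (u i) t j with hg
  have hdiff : ∀ t j, g u t j - g u' t j = G i (u i) t j - G i (u' i) t j := by
    intro t j
    simp only [hg]
    rw [← Finset.sum_sub_distrib, Finset.sum_eq_single i]
    · intro k _ hk
      rw [hne k hk, sub_self]
    · simp
  have hsum : ∀ T : ℕ, ∑ t ∈ Finset.range (T + 1), ∑ j, |g u t j - g u' t j| ≤ B := by
    intro T
    simp only [hdiff]
    have h1 := hgain i (u i) (u' i) T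
    have h2 : ENNReal.ofReal (∑ t ∈ Finset.range (T + 1), ∑ j,
        |G i (u i) t j - G i (u' i) t j|) ≤ ENNReal.ofReal (γ i * b i) := by
      rw [ENNReal.ofReal_mul (hγ i)]
      refine h1.trans ?_
      gcongr
      exact (seqLpNorm_trunc_le _ _ _).trans hi
    exact ((ENNReal.ofReal_le_ofReal_iff (mul_nonneg (hγ i) (hb i))).1 h2).trans (hB i)
  have hmeas : ∀ u, Measurable (fun (w : ℕ → Fin m' → ℝ) t j => g u t j + w t j) := by
    intro u; fun_prop
  have hM' : ∀ u, M u = W.map (fun w t j => g u t j + w t j) := hM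
  have : ∀ u, IsFiniteMeasure (M u) := by
    intro u; rw [hM']; infer_instance
  have hfin : ∀ (T : ℕ) (u) (S : Set (Fin (T + 1) → Fin m' → ℝ)), MeasurableSet S →
      M u ((fun w (i : Fin (T + 1)) => w i) ⁻¹' S) =
      (Measure.pi (fun _ : Fin (T + 1) => Measure.pi (fun _ : Fin m' => laplaceMeasure B ε))).map
        (fun w (t : Fin (T + 1)) j => g u t j + w t j) S := by
    intro T u S hS
    have hp : Measurable (fun (w : ℕ → Fin m' → ℝ) (i : Fin (T + 1)) => w i) := by fun_prop
    have hq : Measurable (fun (w : Fin (T + 1) → Fin m' → ℝ) (t : Fin (T + 1)) j =>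
      g u t j + w t j) := by fun_prop
    rw [← hW T, Measure.map_map hq hp, Measure.map_apply (hq.comp hp) hS, hM',
      Measure.map_apply (hmeas u) (hp hS)]
    rfl
  have := le_of_le_on_ring (M u) (M u') (Real.exp ε).toNNReal
    (isSetRing_measurableCylinders (α := fun _ : ℕ => Fin m' → ℝ))
    (isSetAlgebra_measurableCylinders (α := fun _ : ℕ => Fin m' → ℝ)).univ_mem
    generateFrom_measurableCylinders.symm ?_ H hH
  · exact this
  intro A hA
  rw [mem_measurableCylinders] at hA
  obtain ⟨s, S, hS, rfl⟩ := hA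
  obtain ⟨T, hT⟩ : ∃ T : ℕ, ∀ k ∈ s, k < T + 1 :=
    ⟨s.sup id, fun k hk => Nat.lt_succ_of_le (Finset.le_sup (f := id) hk)⟩
  let ρ : (Fin (T + 1) → Fin m' → ℝ) → ((k : s) → Fin m' → ℝ) :=
    fun w k => w ⟨k.1, hT k.1 k.2⟩
  have hρ : Measurable ρ := by
    refine measurable_pi_lambda _ fun k => measurable_pi_apply _
  have hcyl : cylinder (α := fun _ : ℕ => Fin m' → ℝ) s S =
      (fun (w : ℕ → Fin m' → ℝ) (i : Fin (T + 1)) => w i) ⁻¹' (ρ ⁻¹' S) := rfl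
  rw [hcyl, hfin T u _ (hρ hS), hfin T u' _ (hρ hS)]
  exact pi_map_laplace_le (T + 1) B ε (g u) (g u') hB0 hε (hsum T) _
end

section
/- Dynamic Gaussian mechanism: for 1 ≤ i ≤ n let 𝒢ᵢ map sequences ℕ → ℝ^{mᵢ} to sequences ℕ → ℝ^{m'}, with ℓ_{rᵢ}-to-ℓ₂ incremental gain at most γᵢ (for all v, v' and T: (Σ_{t=0}^{T} ‖(𝒢ᵢv)_t − (𝒢ᵢv')_t‖₂²)^{1/2} ≤ γᵢ ‖P_T(v−v')‖_{rᵢ}), and set 𝒢(u₁,…,u_n) = Σᵢ 𝒢ᵢuᵢ. Let ε > 0, δ ∈ (0,1/2), let K ≥ 0 satisfy 𝒬(K) = δ where 𝒬(x) = (1/√(2π))∫ₓ^∞ e^{−u²/2}du, set κ(δ,ε) = (K + √(K² + 2ε))/(2ε), and let σ ≥ κ(δ,ε) · max_{1≤i≤n} γᵢ bᵢ. Define the mechanism M by letting M(u) be the law of 𝒢u + w on (ℝ^{m'})^ℕ with its product σ-algebra, where the entries of w (over time and coordinates) are i.i.d. centered Gaussians of variance σ²; that is, M(u) is the pushforward of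 the countable product of N(0,σ²) measures under w ↦ 𝒢u + w. Then M is (ε,δ)-differentially private for Adj^b: for adjacent u, u' and all measurable H, M(u)(H) ≤ e^ε · M(u')(H) + δ. -/
open MeasureTheory ProbabilityTheory ENNReal

lemma dgm_map_sum {ι : Type*} [Fintype ι] {Ω : ι → Type*} [mΩ : ∀ i, MeasurableSpace (Ω i)]
    (μ : (i : ι) → Measure (Ω i)) [∀ i, IsProbabilityMeasure (μ i)]
    (X : (i : ι) → Ω i → ℝ) (hX : ∀ i, Measurable (X i)) (v : ι → NNReal)
    (h : ∀ i, (μ i).map (X i) = gaussianReal 0 (v i)) :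
    (Measure.pi μ).map (fun ω => ∑ i, X i (ω i)) = gaussianReal 0 (∑ i, v i) := by
  classical
  have hind : iIndepFun (fun i (ω : (i : ι) → Ω i) => X i (ω i)) (Measure.pi μ) :=
    iIndepFun_pi (fun i => (hX i).aemeasurable)
  have hm : ∀ i, Measurable (fun (ω : (i : ι) → Ω i) => X i (ω i)) :=
    fun i => (hX i).comp (measurable_pi_apply i)
  have key : ∀ s : Finset ι, (Measure.pi μ).map (∑ i ∈ s, fun (ω : (i : ι) → Ω i) => X i (ω i))
      = gaussianReal 0 (∑ i ∈ s, v i) := by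
    intro s
    induction s using Finset.cons_induction with
    | empty =>
      simp only [Finset.sum_empty, gaussianReal_zero_var]
      change (Measure.pi μ).map (fun _ => (0:ℝ)) = _
      rw [Measure.map_const]; simp
    | cons j s hj ih =>
      rw [Finset.sum_cons, Finset.sum_cons]
      have := gaussianReal_add_gaussianReal_of_indepFun (m₁ := 0) (m₂ := 0) (v₁ := v j)
        (hind.indepFun_finsetSum_of_notMem hm hj).symm ?_ ih
      · simpa using this
      · rw [← h j, ← (measurePreserving_eval μ j).map_eq,
          Measure.map_map (hX j) (measurable_pi_apply j)]
        rfl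
  have := key Finset.univ
  rw [← this]
  congr 1
  ext ω
  simp

lemma dgm_pi_density {ι : Type*} [Fintype ι] {Ω : ι → Type*} [mΩ : ∀ i, MeasurableSpace (Ω i)]
    (μ ν : (i : ι) → Measure (Ω i)) [∀ i, IsProbabilityMeasure (μ i)]
    [∀ i, IsProbabilityMeasure (ν i)]
    (f : (i : ι) → Ω i → ℝ≥0∞) (hf : ∀ i, Measurable (f i))
    (h : ∀ i, ν i = (μ i).withDensity (f i)) :
    Measure.pi ν = (Measure.pi μ).withDensity (fun ω => ∏ i, f i (ω i)) := by
  classical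
  refine Measure.pi_eq ?_
  intro s hs
  rw [withDensity_apply _ (MeasurableSet.univ_pi hs), ← lintegral_indicator (MeasurableSet.univ_pi hs)]
  have hm : ∀ i, Measurable ((s i).indicator (f i)) := fun i => (hf i).indicator (hs i)
  have hind : iIndepFun (fun i (ω : (i : ι) → Ω i) => (s i).indicator (f i) (ω i)) (Measure.pi μ) :=
    iIndepFun_pi (fun i => (hm i).aemeasurable)
  have e : (Set.univ.pi s).indicator (fun ω => ∏ i, f i (ω i))
      = fun ω : (i : ι) → Ω i => ∏ i, (s i).indicator (f i) (ω i) := by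
    ext ω
    by_cases hω : ω ∈ Set.univ.pi s
    · rw [Set.indicator_of_mem hω]
      refine Finset.prod_congr rfl fun i _ => ?_
      rw [Set.indicator_of_mem (hω i (Set.mem_univ i))]
    · rw [Set.indicator_of_notMem hω]
      simp only [Set.mem_pi, Set.mem_univ, true_implies, not_forall] at hω
      obtain ⟨i, hi⟩ := hω
      rw [Finset.prod_eq_zero (Finset.mem_univ i)]
      rw [Set.indicator_of_notMem hi]
  rw [e, lintegral_prod_eq_prod_lintegral_of_indepFun Finset.univ _ hind
    (fun i => (hm i).comp (measurable_pi_apply i))]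
  refine Finset.prod_congr rfl fun i _ => ?_
  rw [h i, withDensity_apply _ (hs i), ← lintegral_indicator (hs i)]
  exact (measurePreserving_eval μ i).lintegral_comp (hm i)

lemma dgm_gauss_density (d : ℝ) (v : NNReal) (hv : v ≠ 0) :
    gaussianReal d v = (gaussianReal 0 v).withDensity
      (fun x => ENNReal.ofReal (Real.exp ((2 * d * x - d ^ 2) / (2 * v)))) := by
  rw [gaussianReal_of_var_ne_zero _ hv, gaussianReal_of_var_ne_zero _ hv,
    ← withDensity_mul _ (measurable_gaussianPDF 0 v) (by fun_prop)]
  congr 1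
  ext x
  have hv' : (v : ℝ) ≠ 0 := by exact_mod_cast hv
  simp only [Pi.mul_apply, gaussianPDF, gaussianPDFReal]
  rw [← ENNReal.ofReal_mul (by positivity), mul_assoc (Real.sqrt _)⁻¹, ← Real.exp_add]
  congr 3
  field_simp
  ring

lemma dgm_real_ineq (ε K σ a : ℝ) (hε : 0 < ε) (hK : 0 ≤ K) (hσ : 0 ≤ σ) (ha : 0 ≤ a)
    (h : (K + Real.sqrt (K ^ 2 + 2 * ε)) / (2 * ε) * a ≤ σ) :
    σ * a * K ≤ σ ^ 2 * ε - a ^ 2 / 2 := by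
  set R := Real.sqrt (K ^ 2 + 2 * ε) with hR
  have hR2 : R ^ 2 = K ^ 2 + 2 * ε := Real.sq_sqrt (by positivity)
  have hRK : K ≤ R := Real.le_sqrt_of_sq_le (by linarith)
  have h1 : (K + R) * a ≤ 2 * ε * σ := by
    rw [div_mul_eq_mul_div, div_le_iff₀ (by positivity)] at h
    linarith
  have h2 : 0 ≤ (2 * ε * σ - (K + R) * a) * (2 * ε * σ + (R - K) * a) :=
    mul_nonneg (by linarith) (add_nonneg (by positivity) (mul_nonneg (by linarith) ha))
  have h3 : (2 * ε * σ - (K + R) * a) * (2 * ε * σ + (R - K) * a)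
      = (4 * ε) * (σ ^ 2 * ε - a ^ 2 / 2 - σ * a * K) := by
    linear_combination (-(a^2)) * hR2
  rw [h3] at h2
  have := nonneg_of_mul_nonneg_right h2 (by positivity)
  linarith

lemma dgm_tail (K δ : ℝ)
    (hQK : (1 / Real.sqrt (2 * Real.pi)) * ∫ u in Set.Ioi K, Real.exp (-u ^ 2 / 2) = δ) :
    gaussianReal 0 1 (Set.Ioi K) = ENNReal.ofReal δ := by
  rw [gaussianReal_apply_eq_integral _ one_ne_zero, ← hQK, ← integral_const_mul]
  congr 2
  ext x
  simp [gaussianPDFReal]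

/-- finite-dimensional Gaussian mechanism -/
lemma dgm_finite {p q : ℕ} (d : Fin p → Fin q → ℝ) (ε δ K σ : ℝ) (hε : 0 < ε) (hK : 0 ≤ K)
    (hQK : (1 / Real.sqrt (2 * Real.pi)) * ∫ u in Set.Ioi K, Real.exp (-u ^ 2 / 2) = δ)
    (hσ : 0 < σ)
    (hd : (K + Real.sqrt (K ^ 2 + 2 * ε)) / (2 * ε) * Real.sqrt (∑ t, ∑ j, d t j ^ 2) ≤ σ)
    (S : Set (Fin p → Fin q → ℝ)) (hS : MeasurableSet S) :
    (Measure.pi (fun _ : Fin p =>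
        Measure.pi (fun _ : Fin q => gaussianReal 0 ((σ ^ 2).toNNReal)))).map
        (fun w t j => w t j + d t j) S ≤
      ENNReal.ofReal (Real.exp ε) * (Measure.pi (fun _ : Fin p =>
        Measure.pi (fun _ : Fin q => gaussianReal 0 ((σ ^ 2).toNNReal)))) S
      + ENNReal.ofReal δ := by
  set v : NNReal := (σ ^ 2).toNNReal with hvdef
  have hvr : (v : ℝ) = σ ^ 2 := Real.coe_toNNReal _ (by positivity)
  have hv : v ≠ 0 := by
    intro h; rw [h] at hvr; simp at hvr; exact absurd hvr.symm (by positivity)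
  set g := Measure.pi (fun _ : Fin p => Measure.pi (fun _ : Fin q => gaussianReal 0 v)) with hg
  have hshift : g.map (fun w t j => w t j + d t j)
      = Measure.pi (fun t : Fin p => Measure.pi (fun j : Fin q => gaussianReal (d t j) v)) := by
    have h1 : ∀ t, (Measure.pi (fun _ : Fin q => gaussianReal 0 v)).map
        (fun (w : Fin q → ℝ) j => w j + d t j) = Measure.pi (fun j : Fin q => gaussianReal (d t j) v) := by
      intro t
      have e : ∀ j, (gaussianReal 0 v).map (fun x => x + d t j) = gaussianReal (d t j) v :=
        fun j => by rw [gaussianReal_map_add_const, zero_add]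
      rw [Measure.pi_map_pi (μ := fun _ : Fin q => gaussianReal 0 v)
        (f := fun j x => x + d t j) (fun j => by fun_prop)]
      simp only [e]
    have hsf : ∀ t, SigmaFinite ((Measure.pi (fun _ : Fin q => gaussianReal 0 v)).map
        (fun (w : Fin q → ℝ) j => w j + d t j)) := fun t => by rw [h1 t]; infer_instance
    have := Measure.pi_map_pi (μ := fun _ : Fin p => Measure.pi (fun _ : Fin q => gaussianReal 0 v))
        (f := fun t (w : Fin q → ℝ) j => w j + d t j)
        (fun t => Measurable.aemeasurable (by fun_prop))
    rw [hg, this]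
    simp only [h1]
  set L : (Fin p → Fin q → ℝ) → ℝ := fun w => ∑ t, ∑ j, (2 * d t j * w t j - d t j ^ 2) / (2 * v) with hL
  have hLm : Measurable L := by fun_prop
  have hdens : g.map (fun w t j => w t j + d t j)
      = g.withDensity (fun w => ENNReal.ofReal (Real.exp (L w))) := by
    rw [hshift, dgm_pi_density (fun _ : Fin p => Measure.pi (fun _ : Fin q => gaussianReal 0 v)) _
      (fun t w => ∏ j, ENNReal.ofReal (Real.exp ((2 * d t j * w j - d t j ^ 2) / (2 * v))))
      (fun t => by fun_prop)
      (fun t => dgm_pi_density (fun _ : Fin q => gaussianReal 0 v) _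
        (fun j x => ENNReal.ofReal (Real.exp ((2 * d t j * x - d t j ^ 2) / (2 * v))))
        (fun j => by fun_prop) (fun j => dgm_gauss_density (d t j) v hv))]
    congr 1
    ext w
    simp only [hL, Real.exp_sum]
    rw [ENNReal.ofReal_prod_of_nonneg (fun _ _ => by positivity)]
    refine Finset.prod_congr rfl fun t _ => ?_
    rw [ENNReal.ofReal_prod_of_nonneg (fun _ _ => by positivity)]
  set s : ℝ := ∑ t, ∑ j, d t j ^ 2 with hs
  have hs0 : 0 ≤ s := by positivity
  have hlin : g.map (fun w => ∑ t, ∑ j, d t j * w t j)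
      = (gaussianReal 0 1).map (fun z => (σ * Real.sqrt s) * z) := by
    have := dgm_map_sum (fun _ : Fin p => Measure.pi (fun _ : Fin q => gaussianReal 0 v))
      (fun t w => ∑ j, d t j * w j) (fun t => by fun_prop)
      (fun t => ∑ j, NNReal.mk (d t j ^ 2) (sq_nonneg _) * v)
      (fun t => dgm_map_sum (fun _ : Fin q => gaussianReal 0 v) (fun j x => d t j * x)
        (fun j => by fun_prop) (fun j => NNReal.mk (d t j ^ 2) (sq_nonneg _) * v)
        (fun j => by rw [gaussianReal_map_const_mul, mul_zero]))
    rw [this, gaussianReal_map_const_mul, mul_zero]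
    congr 1
    apply NNReal.eq
    push_cast
    simp only [NNReal.coe_mk, hvr, mul_pow, Real.sq_sqrt hs0, ← Finset.sum_mul, mul_one]
    rw [mul_comm]
  have hB : g.map (fun w t j => w t j + d t j) {w | ε < L w} ≤ ENNReal.ofReal δ := by
    rw [Measure.map_apply (by fun_prop) (measurableSet_lt measurable_const hLm)]
    have e : (fun (w : Fin p → Fin q → ℝ) t j => w t j + d t j) ⁻¹' {w | ε < L w}
        = (fun w => ∑ t, ∑ j, d t j * w t j) ⁻¹' Set.Ioi (σ ^ 2 * ε - s / 2) := by
      ext w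
      have : L (fun t j => w t j + d t j) = (∑ t, ∑ j, d t j * w t j) / σ ^ 2 + s / (2 * σ ^ 2) := by
        simp only [hL, hs, Finset.sum_div, ← Finset.sum_add_distrib, hvr]
        refine Finset.sum_congr rfl fun t _ => Finset.sum_congr rfl fun j _ => ?_
        field_simp
        ring
      simp only [Set.mem_preimage, Set.mem_ofPred_eq, Set.mem_Ioi, this]
      rw [show (∑ t, ∑ j, d t j * w t j) / σ ^ 2 + s / (2 * σ ^ 2)
        = ((∑ t, ∑ j, d t j * w t j) + s / 2) / σ ^ 2 by field_simp, lt_div_iff₀ (by positivity)]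
      constructor <;> intro h <;> linarith
    rw [e, ← Measure.map_apply (by fun_prop) measurableSet_Ioi, hlin,
      Measure.map_apply (by fun_prop) measurableSet_Ioi, ← dgm_tail K δ hQK]
    refine measure_mono fun z hz => ?_
    simp only [Set.mem_preimage, Set.mem_Ioi] at hz ⊢
    have h1 := dgm_real_ineq ε K σ (Real.sqrt s) hε hK hσ.le (Real.sqrt_nonneg _) hd
    rw [Real.sq_sqrt hs0] at h1
    exact lt_of_mul_lt_mul_left (h1.trans_lt hz) (by positivity)
  have hA : g.map (fun w t j => w t j + d t j) (S ∩ {w | L w ≤ ε})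
      ≤ ENNReal.ofReal (Real.exp ε) * g S := by
    have hm : MeasurableSet (S ∩ {w | L w ≤ ε}) := hS.inter (measurableSet_le hLm measurable_const)
    rw [hdens, withDensity_apply _ hm]
    calc _ ≤ ∫⁻ w in S ∩ {w | L w ≤ ε}, ENNReal.ofReal (Real.exp ε) ∂g :=
          setLIntegral_mono' hm fun w hw =>
            ENNReal.ofReal_le_ofReal (Real.exp_le_exp.2 hw.2)
      _ = ENNReal.ofReal (Real.exp ε) * g (S ∩ {w | L w ≤ ε}) := by rw [setLIntegral_const]
      _ ≤ _ := by gcongr; exact Set.inter_subset_left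
  calc _ ≤ g.map (fun w t j => w t j + d t j) ((S ∩ {w | L w ≤ ε}) ∪ {w | ε < L w}) := by
        refine measure_mono fun w hw => ?_
        rcases le_or_gt (L w) ε with h | h
        · exact Or.inl ⟨hw, h⟩
        · exact Or.inr h
    _ ≤ _ := (measure_union_le _ _).trans (add_le_add hA hB)

lemma dgm_approx {q : ℕ} (μ ν : Measure (ℕ → Fin q → ℝ)) [IsFiniteMeasure μ] [IsFiniteMeasure ν]
    (c e : ℝ≥0∞) (hc : c ≠ ∞)
    (h : ∀ (T : ℕ) (S : Set (Fin (T + 1) → Fin q → ℝ)), MeasurableSet S →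
      μ ((fun w (i : Fin (T + 1)) => w i) ⁻¹' S) ≤
        c * ν ((fun w (i : Fin (T + 1)) => w i) ⁻¹' S) + e)
    (H : Set (ℕ → Fin q → ℝ)) (hH : MeasurableSet H) : μ H ≤ c * ν H + e := by
  have hcyl : ∀ A ∈ measurableCylinders (fun _ : ℕ => Fin q → ℝ), μ A ≤ c * ν A + e := by
    intro A hA
    rw [measurableCylinders_nat] at hA
    simp only [Set.mem_iUnion, Set.mem_singleton_iff, exists_prop] at hA
    obtain ⟨T, S, hS, rfl⟩ := hA
    have := h T ((fun (f : Fin (T + 1) → Fin q → ℝ) (i : Finset.Iic T) =>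
      f ⟨i.1, Nat.lt_succ_of_le (Finset.mem_Iic.1 i.2)⟩) ⁻¹' S)
      ((measurable_pi_lambda _ fun i => measurable_pi_apply _) hS)
    exact this
  have hdense := Measure.MeasureDense.of_generateFrom_isSetAlgebra_finite (μ + ν)
    (isSetAlgebra_measurableCylinders (α := fun _ : ℕ => Fin q → ℝ))
    (generateFrom_measurableCylinders (α := fun _ : ℕ => Fin q → ℝ)).symm
  have hstep : ∀ η : ℝ, 0 < η → μ H ≤ c * ν H + e + (c + 1) * ENNReal.ofReal η := by
    intro η hη
    obtain ⟨A, hA, hlt⟩ := hdense.approx H hH (measure_ne_top _ _) η hη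
    rw [Measure.add_apply] at hlt
    have h1 : μ (symmDiff H A) ≤ ENNReal.ofReal η := le_self_add.trans hlt.le
    have h2 : ν (symmDiff H A) ≤ ENNReal.ofReal η := le_add_self.trans hlt.le
    have h3 : μ H ≤ μ A + ENNReal.ofReal η := by
      refine (measure_mono (t := A ∪ symmDiff H A) ?_).trans
        ((measure_union_le _ _).trans (by gcongr))
      intro x hx
      by_cases hxA : x ∈ A
      · exact Or.inl hxA
      · exact Or.inr (Or.inl ⟨hx, hxA⟩)
    have h4 : ν A ≤ ν H + ENNReal.ofReal η := by
      refine (measure_mono (t := H ∪ symmDiff H A) ?_).trans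
        ((measure_union_le _ _).trans (by gcongr))
      intro x hx
      by_cases hxA : x ∈ H
      · exact Or.inl hxA
      · exact Or.inr (Or.inr ⟨hx, hxA⟩)
    calc μ H ≤ (c * ν A + e) + ENNReal.ofReal η := h3.trans (by gcongr; exact hcyl A hA)
      _ ≤ (c * (ν H + ENNReal.ofReal η) + e) + ENNReal.ofReal η := by gcongr
      _ = _ := by ring
  have ht : Filter.Tendsto (fun η : ℝ => c * ν H + e + (c + 1) * ENNReal.ofReal η)
      (nhdsWithin 0 (Set.Ioi 0)) (nhds (c * ν H + e + (c + 1) * ENNReal.ofReal 0)) := by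
    refine Filter.Tendsto.mono_left ?_ nhdsWithin_le_nhds
    refine Filter.Tendsto.const_add _ (ENNReal.Tendsto.const_mul ?_ (Or.inr (by simp [hc])))
    exact ENNReal.tendsto_ofReal Filter.tendsto_id
  have := ge_of_tendsto ht (Filter.eventually_of_mem self_mem_nhdsWithin fun η hη => hstep η hη)
  simpa using this

/-- dynamic Gaussian mechanism: if each `𝒢ᵢ` has ℓ_{rᵢ}-to-ℓ₂ incremental
gain at most `γᵢ`, `ε > 0`, `δ ∈ (0,1/2)`, `K ≥ 0` satisfies `𝒬(K) = δ`,
`κ(δ,ε) = (K + √(K²+2ε))/(2ε)` and `σ ≥ κ(δ,ε)·max_i γᵢbᵢ`, then the mechanism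
`M u = law of 𝒢u + w`, where the entries of the noise `w` over all times and coordinates
are i.i.d. `N(0,σ²)` (the noise law `W` being the countable product of `N(0,σ²)`
measures, characterized by its finite-dimensional marginals), is `(ε,δ)`-differentially
private for `Adj^b`. -/
theorem dynamic_gaussian_mechanism_dp
    {n : ℕ} {m : Fin n → ℕ} {m' : ℕ}
    (G : (i : Fin n) → (ℕ → Fin (m i) → ℝ) → (ℕ → Fin m' → ℝ))
    (r : Fin n → ℝ≥0∞) (hr : ∀ i, 1 ≤ r i)
    (γ b : Fin n → ℝ) (hγ : ∀ i, 0 ≤ γ i) (hb : ∀ i, 0 ≤ b i)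
    (hgain : ∀ i (v v' : ℕ → Fin (m i) → ℝ) (T : ℕ),
      ENNReal.ofReal (Real.sqrt
          (∑ t ∈ Finset.range (T + 1), ∑ j, (G i v t j - G i v' t j) ^ 2)) ≤
        ENNReal.ofReal (γ i) * seqLpNorm (r i) (seqTrunc T (fun t j => v t j - v' t j)))
    (ε δ K σ : ℝ) (hε : 0 < ε) (hδ : 0 < δ) (hδ' : δ < 1 / 2) (hK : 0 ≤ K)
    (hQK : (1 / Real.sqrt (2 * Real.pi)) * ∫ u in Set.Ioi K, Real.exp (-u ^ 2 / 2) = δ)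
    (hσ : ∀ i, (K + Real.sqrt (K ^ 2 + 2 * ε)) / (2 * ε) * (γ i * b i) ≤ σ)
    (W : Measure (ℕ → Fin m' → ℝ)) (hWprob : IsProbabilityMeasure W)
    (hW : ∀ T : ℕ, W.map (fun w (i : Fin (T + 1)) => w i) =
      Measure.pi (fun _ : Fin (T + 1) =>
        Measure.pi (fun _ : Fin m' => gaussianReal 0 ((σ ^ 2).toNNReal))))
    (M : ((i : Fin n) → ℕ → Fin (m i) → ℝ) → Measure (ℕ → Fin m' → ℝ))
    (hM : ∀ u, M u = W.map (fun w t j => (∑ i, G i (u i) t j) + w t j)) :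
    ∀ u u', (∃ i, (∀ j, j ≠ i → u j = u' j) ∧
        seqLpNorm (r i) (fun t j => u i t j - u' i t j) ≤ ENNReal.ofReal (b i)) →
      ∀ H : Set (ℕ → Fin m' → ℝ), MeasurableSet H →
        M u H ≤ ENNReal.ofReal (Real.exp ε) * M u' H + ENNReal.ofReal δ := by
  rintro u u' ⟨i, hne, hadj⟩ H hH
  set a : ℕ → Fin m' → ℝ := fun t j => ∑ i, G i (u i) t j with ha
  set a' : ℕ → Fin m' → ℝ := fun t j => ∑ i, G i (u' i) t j with ha'
  have hdiff : ∀ t j, a t j - a' t j = G i (u i) t j - G i (u' i) t j := by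
    intro t j
    simp only [ha, ha', ← Finset.sum_sub_distrib]
    refine Finset.sum_eq_single i (fun k _ hk => ?_) (by simp)
    rw [hne k hk, sub_self]
  have hbound : ∀ T : ℕ, Real.sqrt (∑ t ∈ Finset.range (T + 1), ∑ j, (a t j - a' t j) ^ 2)
      ≤ γ i * b i := by
    intro T
    simp only [hdiff]
    have h1 : seqLpNorm (r i) (seqTrunc T (fun t j => u i t j - u' i t j))
        ≤ ENNReal.ofReal (b i) := by
      refine le_trans ?_ hadj
      unfold seqLpNorm
      refine eLpNorm_mono fun x => ?_
      unfold seqTrunc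
      split_ifs <;> simp
    have h2 := (hgain i (u i) (u' i) T).trans (mul_le_mul_right h1 _)
    rw [← ENNReal.ofReal_mul (hγ i)] at h2
    exact (ENNReal.ofReal_le_ofReal_iff (mul_nonneg (hγ i) (hb i))).1 h2
  have hκ : 0 < (K + Real.sqrt (K ^ 2 + 2 * ε)) / (2 * ε) := by
    have : 0 < Real.sqrt (K ^ 2 + 2 * ε) := Real.sqrt_pos.2 (by positivity)
    positivity
  have hσ0 : 0 ≤ σ := le_trans (mul_nonneg hκ.le (mul_nonneg (hγ i) (hb i))) (hσ i)
  have hmeas : ∀ c : ℕ → Fin m' → ℝ, Measurable (fun (w : ℕ → Fin m' → ℝ) t j => c t j + w t j) := by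
    intro c; fun_prop
  have hMu : M u = W.map (fun w t j => a t j + w t j) := hM u
  have hMu' : M u' = W.map (fun w t j => a' t j + w t j) := hM u'
  rcases hσ0.eq_or_lt with h0 | hpos
  · have hz : γ i * b i ≤ 0 := by
      have := hσ i
      rw [← h0] at this
      exact nonpos_of_mul_nonpos_right this hκ
    have haa : a = a' := by
      ext t j
      have h1 := (hbound t).trans hz
      rw [Real.sqrt_le_left le_rfl] at h1
      have h2 : (a t j - a' t j) ^ 2 ≤ ∑ t' ∈ Finset.range (t + 1), ∑ j, (a t' j - a' t' j) ^ 2 :=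
        (Finset.single_le_sum (f := fun j => (a t j - a' t j) ^ 2)
          (fun _ _ => sq_nonneg _) (Finset.mem_univ j)).trans
        (Finset.single_le_sum (f := fun t' => ∑ j, (a t' j - a' t' j) ^ 2)
          (fun _ _ => Finset.sum_nonneg fun _ _ => sq_nonneg _) (by simp))
      have h3 : (a t j - a' t j) ^ 2 = 0 := le_antisymm (by linarith) (sq_nonneg _)
      exact sub_eq_zero.1 (pow_eq_zero_iff (by norm_num) |>.1 h3)
    rw [hMu, hMu', haa]
    refine le_trans ?_ le_self_add
    refine le_mul_of_one_le_left (by simp) ?_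
    rw [← ENNReal.ofReal_one]
    exact ENNReal.ofReal_le_ofReal (Real.one_le_exp hε.le)
  · have : IsProbabilityMeasure (M u) := by
      rw [hMu]; exact Measure.isProbabilityMeasure_map (hmeas a).aemeasurable
    have : IsProbabilityMeasure (M u') := by
      rw [hMu']; exact Measure.isProbabilityMeasure_map (hmeas a').aemeasurable
    refine dgm_approx (M u) (M u') _ _ ENNReal.ofReal_ne_top ?_ H hH
    intro T S hS
    have hπ : Measurable (fun (w : ℕ → Fin m' → ℝ) (i : Fin (T + 1)) => w i) := by fun_prop
    have hsh : ∀ c : ℕ → Fin m' → ℝ, Measurable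
        (fun (w : Fin (T + 1) → Fin m' → ℝ) (t : Fin (T + 1)) j => c t j + w t j) := by
      intro c; fun_prop
    have hred : ∀ c : ℕ → Fin m' → ℝ, W.map (fun w t j => c t j + w t j)
        ((fun w (i : Fin (T + 1)) => w i) ⁻¹' S) =
        (Measure.pi (fun _ : Fin (T + 1) =>
          Measure.pi (fun _ : Fin m' => gaussianReal 0 ((σ ^ 2).toNNReal))))
          ((fun w (t : Fin (T + 1)) j => c t j + w t j) ⁻¹' S) := by
      intro c
      rw [Measure.map_apply (hmeas c) (hπ hS), ← hW T, Measure.map_apply hπ (hsh c hS)]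
      rfl
    rw [hMu, hMu', hred, hred]
    have := dgm_finite (fun (t : Fin (T + 1)) j => a t j - a' t j) ε δ K σ hε hK hQK hpos ?_
      ((fun w (t : Fin (T + 1)) j => a' t j + w t j) ⁻¹' S) (hsh a' hS)
    · rw [Measure.map_apply (by fun_prop) (hsh a' hS)] at this
      refine le_trans (le_of_eq ?_) this
      congr 1
      ext w
      simp only [Set.mem_preimage]
      have e : (fun (t : Fin (T + 1)) j => a t j + w t j)
        = fun (t : Fin (T + 1)) j => a' t j + (w t j + (a t j - a' t j)) := by
        ext t j; ring
      rw [e]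
    · have h1 := hbound T
      rw [← Fin.sum_univ_eq_sum_range (fun t => ∑ j, (a t j - a' t j) ^ 2)] at h1
      exact (mul_le_mul_of_nonneg_left h1 hκ.le).trans (hσ i)
end
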